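/- arXiv:1704.03771 — 2 statements merged into one kernel-verified Lean document; each statement's English description precedes it below -/
import Mathlib

section
/- (Distributional Wiener–Ikehara theorem.) Let S : ℝ → ℝ be nondecreasing with S(x) = 0 for x < 1, and let a ≥ 0. Then S(x)/x → a as x → ∞ if and only if the Mellin–Stieltjes transform F(s) = ∫_{[1,∞)} x^{−s} dS(x) converges for every s with Re s > 1 and the function s ↦ F(s) − a/(s − 1) has local pseudofunction boundary behavior on the line 1 + iℝ. -/
open Filter MeasureTheory Set Topology
open scoped Classical

/-- Value `n(α) = ∏ p_k^{α(k)}` of a generalized integer `α`. -/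
noncomputable def nval (p : ℕ → ℝ) (α : ℕ →₀ ℕ) : ℝ := α.prod fun k e => p k ^ e

/-- Counting function `N(x)` of the generalized integers. -/
noncomputable def Ncount (p : ℕ → ℝ) (x : ℝ) : ℕ := Nat.card {α : ℕ →₀ ℕ // nval p α ≤ x}

/-- Riemann prime counting function `Π(x) = Σ_{j ≥ 1} π(x^{1/j})/j`. -/
noncomputable def PiCount (p : ℕ → ℝ) (x : ℝ) : ℝ :=
  ∑' j : ℕ, (Nat.card {k : ℕ // p k ≤ x ^ ((1 : ℝ) / (j + 1))} : ℝ) / (j + 1)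

/-- `log ζ(s) = ∫_1^∞ x^{-s} dΠ(x)`, the Lebesgue–Stieltjes integral against the purely
atomic measure `dΠ`, which carries mass `1/j` at each point `p_k^j`. -/
noncomputable def logZeta (p : ℕ → ℝ) (s : ℂ) : ℂ :=
  ∑' (j : ℕ) (k : ℕ), ((p k : ℂ) ^ (-s * (j + 1))) / (j + 1)

/-- The Beurling zeta function `ζ(s) = exp(∫_1^∞ x^{-s} dΠ(x))`. -/
noncomputable def zetaB (p : ℕ → ℝ) (s : ℂ) : ℂ := Complex.exp (logZeta p s)

/-- Beurling Möbius function. -/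
noncomputable def muB (α : ℕ →₀ ℕ) : ℝ :=
  if ∀ k, α k ≤ 1 then (-1 : ℝ) ^ α.support.card else 0

/-- `m(x) = Σ_{n(α) ≤ x} μ(α)/n(α)`. -/
noncomputable def mB (p : ℕ → ℝ) (x : ℝ) : ℝ :=
  ∑' α : {α : ℕ →₀ ℕ // nval p α ≤ x}, muB α / nval p α

/-- Beurling Liouville function. -/
noncomputable def lambdaB (α : ℕ →₀ ℕ) : ℝ := (-1 : ℝ) ^ (α.sum fun _ e => e)

/-- `ℓ(x) = Σ_{n(α) ≤ x} λ(α)/n(α)`. -/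
noncomputable def ellB (p : ℕ → ℝ) (x : ℝ) : ℝ :=
  ∑' α : {α : ℕ →₀ ℕ // nval p α ≤ x}, lambdaB α / nval p α

/-- An analytic function `G` on `{Re s > 1}` has `A_loc`-boundary behavior on `1 + iU`:
for every compact `K ⊂ U` there is `g ∈ L¹(ℝ)` with `G(σ + it) → ∫ g(x) e^{-itx} dx`
as `σ → 1⁺`, uniformly for `t ∈ K`. -/
def ALocBoundary (G : ℂ → ℂ) (U : Set ℝ) : Prop :=
  ∀ K : Set ℝ, K ⊆ U → IsCompact K → ∃ g : ℝ → ℂ, Integrable g ∧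
    TendstoUniformlyOn (fun σ : ℝ => fun t : ℝ => G (σ + t * Complex.I))
      (fun t : ℝ => ∫ x : ℝ, g x * Complex.exp (-(t * x) * Complex.I)) (𝓝[>] 1) K

/-- An analytic function `G` on `{Re s > 1}` has local pseudofunction boundary behavior on
`1 + iU`: for every smooth compactly supported `φ` with `supp φ ⊂ U` and every `x`, the limit
`g_φ(x) = lim_{σ→1⁺} ∫ G(σ + it) φ(t) e^{-ixt} dt` exists, and `g_φ(x) → 0` as `|x| → ∞`. -/
def LocalPseudofunctionBoundary (G : ℂ → ℂ) (U : Set ℝ) : Prop :=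
  ∀ φ : ℝ → ℂ, ContDiff ℝ (⊤ : ℕ∞) φ → HasCompactSupport φ → tsupport φ ⊆ U →
    ∃ gφ : ℝ → ℂ,
      (∀ x : ℝ, Tendsto (fun σ : ℝ => ∫ t : ℝ, G (σ + t * Complex.I) * φ t *
          Complex.exp (-(x * t) * Complex.I)) (𝓝[>] 1) (𝓝 (gφ x))) ∧
      Tendsto gφ (cocompact ℝ) (𝓝 0)

/-- `Π₀(x) = ∫_1^x (1 - 1/u)/log u du`. -/
noncomputable def Pi0 (x : ℝ) : ℝ := ∫ u in (1:ℝ)..x, (1 - 1/u) / Real.log u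

open scoped FourierTransform in
/-- Fourier transform without the `2π`. -/
noncomputable def fhat (φ : ℝ → ℂ) (x : ℝ) : ℂ := ∫ t : ℝ, φ t * Complex.exp (-(x * t) * Complex.I)

open scoped FourierTransform in
lemma fhat_eq (φ : ℝ → ℂ) (x : ℝ) : fhat φ x = 𝓕 φ (x / (2 * Real.pi)) := by
  rw [Real.fourier_real_eq_integral_exp_smul, fhat]
  congr 1; ext t
  rw [smul_eq_mul, mul_comm]
  congr 2
  have : (Real.pi : ℂ) ≠ 0 := by exact_mod_cast Real.pi_ne_zero
  push_cast
  field_simp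

open scoped FourierTransform in
lemma fhat_integrable {φ : ℝ → ℂ} (h1 : ContDiff ℝ (⊤ : ℕ∞) φ) (h2 : HasCompactSupport φ) :
    Integrable (fhat φ) := by
  have h := (𝓕 (h2.toSchwartzMap h1)).integrable (μ := volume)
  rw [SchwartzMap.fourier_coe] at h
  have h' : Integrable (𝓕 φ) := h
  have := h'.comp_div (R := (2 * Real.pi)) (by positivity)
  exact this.congr (Eventually.of_forall fun x => (fhat_eq φ x).symm)

open scoped FourierTransform in
lemma fhat_continuous {φ : ℝ → ℂ} (h1 : ContDiff ℝ (⊤ : ℕ∞) φ) (h2 : HasCompactSupport φ) :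
    Continuous (fhat φ) := by
  have h := (𝓕 (h2.toSchwartzMap h1)).continuous
  rw [SchwartzMap.fourier_coe] at h
  have h' : Continuous (𝓕 φ) := h
  rw [show fhat φ = fun x => 𝓕 φ (x / (2 * Real.pi)) from funext (fhat_eq φ)]
  exact h'.comp (by fun_prop)

open scoped FourierTransform in
lemma fhat_tendsto (φ : ℝ → ℂ) :
    Tendsto (fhat φ) (cocompact ℝ) (𝓝 0) := by
  rw [show fhat φ = fun x => 𝓕 φ (x / (2 * Real.pi)) from funext (fhat_eq φ)]
  refine (Real.zero_at_infty_fourier φ).comp ?_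
  have := (Homeomorph.mulRight₀ ((2 * Real.pi)⁻¹) (by positivity)).isClosedEmbedding.tendsto_cocompact
  simpa [div_eq_mul_inv] using this

lemma fhat_fubini {q φ : ℝ → ℂ} (hq : Integrable q) (hφ : Integrable φ) (x : ℝ) :
    ∫ t : ℝ, (∫ w : ℝ, q w * Complex.exp (-(t * w) * Complex.I)) * φ t *
      Complex.exp (-(x * t) * Complex.I) = ∫ w : ℝ, q w * fhat φ (x + w) := by
  have hintg : Integrable (Function.uncurry fun (t w : ℝ) =>
      q w * Complex.exp (-(t * w) * Complex.I) * φ t *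
      Complex.exp (-(x * t) * Complex.I)) (volume.prod volume) := by
    have h := hφ.mul_prod hq
    have h2 : Continuous (fun z : ℝ × ℝ => Complex.exp (-((z.1 : ℂ) * z.2) * Complex.I) *
      Complex.exp (-((x : ℂ) * z.1) * Complex.I)) := by fun_prop
    refine (h.mul_bdd (c := 1) h2.aestronglyMeasurable (Eventually.of_forall fun z => ?_)).congr
      (Eventually.of_forall fun z => ?_)
    · rw [norm_mul, Complex.norm_exp, Complex.norm_exp]; simp
    · simp only [Function.uncurry]; ring
  have e1 : ∀ t : ℝ, (∫ w : ℝ, q w * Complex.exp (-(t * w) * Complex.I)) * φ t *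
      Complex.exp (-(x * t) * Complex.I) = ∫ w : ℝ, q w * Complex.exp (-(t * w) * Complex.I) * φ t *
      Complex.exp (-(x * t) * Complex.I) := by
    intro t; rw [integral_mul_const, integral_mul_const]
  simp_rw [e1]
  rw [integral_integral_swap hintg]
  congr 1; ext w
  rw [fhat, ← integral_const_mul]
  congr 1; ext t
  rw [show (-(((x + w : ℝ) : ℂ) * t) * Complex.I) =
    (-((t : ℂ) * w) * Complex.I) + (-((x : ℂ) * t) * Complex.I) by push_cast; ring, Complex.exp_add]
  ring

lemma fhat_comp_div (φ : ℝ → ℂ) {c : ℝ} (hc : 0 < c) (x : ℝ) :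
    fhat (fun t => φ (t / c)) x = c * fhat φ (c * x) := by
  have := Measure.integral_comp_div (fun t : ℝ => φ t * Complex.exp (-((c * x : ℝ) * t) * Complex.I)) c
  rw [abs_of_pos hc] at this
  rw [fhat, fhat, ← Complex.real_smul, ← this]
  congr 1; ext t
  congr 3
  have : (c : ℂ) ≠ 0 := by exact_mod_cast hc.ne'
  push_cast
  field_simp

lemma fhat_const_mul (φ : ℝ → ℂ) (c : ℂ) (x : ℝ) :
    fhat (fun t => c * φ t) x = c * fhat φ x := by
  rw [fhat, fhat, ← integral_const_mul]
  congr 1; ext t; ring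

open scoped Convolution in
lemma conv_smooth {f : ℝ → ℂ} (hf1 : ContDiff ℝ (⊤ : ℕ∞) f) (hf2 : HasCompactSupport f) :
    ContDiff ℝ (⊤ : ℕ∞) (f ⋆[ContinuousLinearMap.mul ℂ ℂ] f) := by
  have h := HasCompactSupport.contDiff_convolution_right (μ := volume) (ContinuousLinearMap.mul ℝ ℂ) hf2
      hf1.continuous.locallyIntegrable hf1
  have e : (f ⋆[ContinuousLinearMap.mul ℂ ℂ] f) = (f ⋆[ContinuousLinearMap.mul ℝ ℂ] f) := by
    ext x; simp only [convolution_def, ContinuousLinearMap.mul_apply']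
  rw [e]; exact h

lemma exists_bump : ∃ f : ℝ → ℂ, ContDiff ℝ (⊤ : ℕ∞) f ∧ HasCompactSupport f ∧
    (∀ x, (starRingEnd ℂ) (fhat f x) = fhat f x) ∧ fhat f 0 ≠ 0 := by
  obtain ⟨b⟩ : Nonempty (ContDiffBump (0 : ℝ)) := ⟨⟨1, 2, by norm_num, by norm_num⟩⟩
  refine ⟨fun t => (b t : ℂ), Complex.ofRealCLM.contDiff.comp b.contDiff,
    b.hasCompactSupport.comp_left (g := fun x : ℝ => (x : ℂ)) (by simp), fun x => ?_, ?_⟩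
  · rw [fhat, ← integral_conj, ← integral_neg_eq_self]
    congr 1; ext t
    have hb : b (-t) = b t := b.neg t
    simp only [map_mul, Complex.conj_ofReal, hb, ← Complex.exp_conj, map_neg, Complex.conj_I]
    congr 2; push_cast; ring
  · have : fhat (fun t => (b t : ℂ)) 0 = ((∫ t, b t : ℝ) : ℂ) := by
      rw [fhat, ← integral_complex_ofReal]; simp
    rw [this]
    exact_mod_cast (b.integral_pos (μ := volume)).ne'

open scoped FourierTransform Convolution in
lemma exists_kernel00 : ∃ φ f : ℝ → ℂ, ContDiff ℝ (⊤ : ℕ∞) φ ∧ HasCompactSupport φ ∧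
    Continuous (fhat f) ∧ fhat f 0 ≠ 0 ∧ ∀ x, fhat φ x = ((‖fhat f x‖ ^ 2 : ℝ) : ℂ) := by
  obtain ⟨f, hf1, hf2, hreal, h0⟩ := exists_bump
  have hfi : Integrable f := hf1.continuous.integrable_of_hasCompactSupport hf2
  refine ⟨f ⋆[ContinuousLinearMap.mul ℂ ℂ] f, f, conv_smooth hf1 hf2,
    HasCompactSupport.convolution _ hf2 hf2, fhat_continuous hf1 hf2, h0, fun x => ?_⟩
  rw [fhat_eq, Real.fourier_mul_convolution_eq hfi hfi, ← fhat_eq]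
  nth_rewrite 1 [← hreal x]
  rw [mul_comm, Complex.mul_conj, Complex.normSq_eq_norm_sq]

lemma exists_kernel0 : ∃ φ : ℝ → ℂ, ContDiff ℝ (⊤ : ℕ∞) φ ∧ HasCompactSupport φ ∧
    ∃ k : ℝ → ℝ, (∀ x, fhat φ x = k x) ∧ (∀ x, 0 ≤ k x) ∧ Integrable k ∧ ∫ x, k x = 1 := by
  obtain ⟨φ, f, hφ1, hφ2, hfc, h0, hk⟩ := exists_kernel00
  have hki : Integrable (fun x => ‖fhat f x‖ ^ 2) := by
    have := (fhat_integrable hφ1 hφ2).re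
    refine this.congr (Eventually.of_forall fun x => ?_)
    simp only [hk]; exact Complex.ofReal_re _
  have hpos : 0 < ∫ x, ‖fhat f x‖ ^ 2 := by
    have hc : Continuous (fun x => ‖fhat f x‖ ^ 2) := by fun_prop
    exact integral_pos_of_integrable_nonneg_nonzero (x := 0) hc hki (fun x => by positivity)
      (by positivity)
  generalize hκ : ∫ x, ‖fhat f x‖ ^ 2 = κ at hpos
  refine ⟨fun t => ((κ⁻¹ : ℝ) : ℂ) * φ t, contDiff_const.mul hφ1, hφ2.mul_left,
    fun x => κ⁻¹ * ‖fhat f x‖ ^ 2, fun x => ?_, fun x => by positivity, hki.const_mul _, ?_⟩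
  · rw [fhat_const_mul, hk]; push_cast; rfl
  · rw [integral_const_mul, hκ]; exact inv_mul_cancel₀ hpos.ne'

lemma exists_kernel {η ε : ℝ} (hη : 0 < η) (hε : 0 < ε) :
    ∃ φ : ℝ → ℂ, ContDiff ℝ (⊤ : ℕ∞) φ ∧ HasCompactSupport φ ∧
    ∃ k : ℝ → ℝ, (∀ x, fhat φ x = k x) ∧ (∀ x, 0 ≤ k x) ∧ Integrable k ∧ ∫ x, k x = 1 ∧
      1 - ε ≤ ∫ x in Icc (-η) η, k x := by
  obtain ⟨φ, h1, h2, k, h3, h4, h5, h6⟩ := exists_kernel0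
  have ht : Tendsto (fun R : ℝ => ∫ x in (-R)..R, k x) atTop (𝓝 1) := by
    rw [← h6]
    exact intervalIntegral_tendsto_integral h5 tendsto_neg_atTop_atBot tendsto_id
  obtain ⟨R, hR1, hR2⟩ := ((ht.eventually (eventually_ge_nhds (show 1 - ε < 1 by linarith))).and
    (eventually_gt_atTop 0)).exists
  set c := R / η
  have hc : 0 < c := by positivity
  refine ⟨fun t => φ (t / c), h1.comp (by fun_prop), ?_, fun x => c * k (c * x), fun x => ?_,
    fun x => mul_nonneg hc.le (h4 _), (h5.comp_mul_left' hc.ne').const_mul _, ?_, ?_⟩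
  · have := h2.comp_homeomorph (Homeomorph.mulRight₀ (c⁻¹) (by positivity))
    exact this
  · rw [fhat_comp_div _ hc, h3]; push_cast; rfl
  · rw [integral_const_mul, Measure.integral_comp_mul_left, h6, abs_of_pos (by positivity)]
    simp; field_simp
  · rw [integral_Icc_eq_integral_Ioc, ← intervalIntegral.integral_of_le (by linarith),
      intervalIntegral.integral_const_mul, intervalIntegral.mul_integral_comp_mul_left]
    have : c * η = R := by simp only [c]; field_simp
    simpa [this] using hR1
/-- Heaviside function. -/
noncomputable def hvs (w : ℝ) : ℝ := if 0 ≤ w then 1 else 0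

lemma hvs_measurable : Measurable hvs :=
  Measurable.ite measurableSet_Ici measurable_const measurable_const

lemma hvs_eq (f : ℝ → ℝ) : (fun w => hvs w * f w) = (Ici (0 : ℝ)).indicator f := by
  ext w; simp [hvs, indicator_apply]

lemma hvs_exp_integrable {δ : ℝ} (hδ : 0 < δ) :
    Integrable (fun w : ℝ => hvs w * Real.exp (-δ * w)) := by
  rw [hvs_eq, integrable_indicator_iff measurableSet_Ici, integrableOn_Ici_iff_integrableOn_Ioi]
  exact integrableOn_exp_mul_Ioi (by linarith) 0

lemma hvs_transform {δ : ℝ} (hδ : 0 < δ) (t : ℝ) :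
    ∫ w : ℝ, ((hvs w * Real.exp (-δ * w) : ℝ) : ℂ) * Complex.exp (-(t * w) * Complex.I)
      = 1 / (δ + t * Complex.I) := by
  have e : (fun w : ℝ => ((hvs w * Real.exp (-δ * w) : ℝ) : ℂ) * Complex.exp (-(t * w) * Complex.I))
      = (Ici (0 : ℝ)).indicator (fun w : ℝ => Complex.exp (-(δ + t * Complex.I) * w)) := by
    ext w
    by_cases hw : 0 ≤ w
    · simp only [hvs, hw, if_true, mem_Ici, indicator_of_mem]
      push_cast
      rw [one_mul, ← Complex.exp_add]
      congr 1; ring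
    · simp [hvs, hw]
  rw [e, integral_indicator measurableSet_Ici, integral_Ici_eq_integral_Ioi,
    integral_exp_mul_complex_Ioi (by simp [hδ])]
  simp [neg_div]
  rw [← inv_neg]; congr 1; ring

lemma transform_continuous {q : ℝ → ℂ} (hq : Integrable q) :
    Continuous (fun t : ℝ => ∫ w : ℝ, q w * Complex.exp (-(t * w) * Complex.I)) := by
  refine continuous_of_dominated (bound := fun w => ‖q w‖) (fun t => ?_) (fun t => ?_) hq.norm ?_
  · exact hq.aestronglyMeasurable.mul (by fun_prop)
  · refine Eventually.of_forall fun w => ?_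
    rw [norm_mul, Complex.norm_exp]; simp
  · exact Eventually.of_forall fun w => by fun_prop

lemma key {h : ℝ → ℝ} {F : ℂ → ℂ} {σ : ℝ} (hσ : 1 < σ) (a : ℝ)
    (hi : Integrable (fun w => h w * Real.exp (-(σ - 1) * w)))
    (hF : ∀ s : ℂ, 1 < s.re → F s = s * ∫ w : ℝ, (h w : ℂ) * Complex.exp (-(s - 1) * w))
    {φ : ℝ → ℂ} (h1 : Continuous φ) (h2 : HasCompactSupport φ) (x : ℝ) :
    ∫ t : ℝ, (F (σ + t * Complex.I) - a / ((σ + t * Complex.I) - 1)) * φ t *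
        Complex.exp (-(x * t) * Complex.I)
      = (∫ w : ℝ, (((h w - a * hvs w) * Real.exp (-(σ - 1) * w) : ℝ) : ℂ) *
          fhat (fun t => (σ + t * Complex.I) * φ t) (x + w)) + a * fhat φ x := by
  have hu := hvs_exp_integrable (sub_pos.2 hσ)
  have hr : Integrable (fun w => (((h w - a * hvs w) * Real.exp (-(σ - 1) * w) : ℝ) : ℂ)) := by
    have e : (fun w => (h w - a * hvs w) * Real.exp (-(σ - 1) * w)) =
      fun w => h w * Real.exp (-(σ - 1) * w) - a * (hvs w * Real.exp (-(σ - 1) * w)) := by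
      ext w; ring
    have h3 : Integrable (fun w => (h w - a * hvs w) * Real.exp (-(σ - 1) * w)) := by
      rw [e]; exact hi.sub (hu.const_mul a)
    exact h3.ofReal
  have hc : Continuous (fun t : ℝ => ((σ : ℂ) + t * Complex.I) * φ t) := by fun_prop
  have hcs : HasCompactSupport (fun t : ℝ => ((σ : ℂ) + t * Complex.I) * φ t) := h2.mul_left
  rw [← fhat_fubini hr (hc.integrable_of_hasCompactSupport hcs), fhat, ← integral_const_mul,
    ← integral_add]
  · congr 1; ext t
    have hre : 1 < ((σ : ℂ) + t * Complex.I).re := by simpa using hσ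
    rw [hF _ hre]
    have e1 : ∫ w : ℝ, (((h w - a * hvs w) * Real.exp (-(σ - 1) * w) : ℝ) : ℂ) *
        Complex.exp (-(t * w) * Complex.I) =
        (∫ w : ℝ, (h w : ℂ) * Complex.exp (-((σ : ℂ) + t * Complex.I - 1) * w)) -
          a * (1 / ((σ - 1 : ℝ) + t * Complex.I)) := by
      rw [← hvs_transform (sub_pos.2 hσ), ← integral_const_mul, ← integral_sub]
      · congr 1; ext w
        rw [show -((σ : ℂ) + t * Complex.I - 1) * w =
          ((-(σ - 1) * w : ℝ) : ℂ) + (-(t * w) * Complex.I) by push_cast; ring, Complex.exp_add]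
        push_cast; ring
      · have h3 : Continuous (fun w : ℝ => Complex.exp (-(t * w) * Complex.I)) := by fun_prop
        refine (hi.ofReal.mul_bdd (c := 1) h3.aestronglyMeasurable
          (Eventually.of_forall fun w => ?_)).congr (Eventually.of_forall fun w => ?_)
        · rw [Complex.norm_exp]; simp
        · simp only
          rw [show -((σ : ℂ) + t * Complex.I - 1) * w =
            ((-(σ - 1) * w : ℝ) : ℂ) + (-(t * w) * Complex.I) by push_cast; ring, Complex.exp_add]
          push_cast; ring_nf
          simp
          ring
      · have h3 : Continuous (fun w : ℝ => Complex.exp (-(t * w) * Complex.I)) := by fun_prop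
        refine (hu.ofReal.mul_bdd (c := 1) h3.aestronglyMeasurable
          (Eventually.of_forall fun w => ?_)).const_mul _
        rw [Complex.norm_exp]; simp
    rw [e1]
    have hne : (σ : ℂ) + t * Complex.I - 1 ≠ 0 := by
      intro h0
      have := congrArg Complex.re h0
      simp at this; linarith
    rw [show (((σ - 1 : ℝ) : ℂ) + t * Complex.I) = (σ : ℂ) + t * Complex.I - 1 by push_cast; ring]
    field_simp
    ring
  · refine Continuous.integrable_of_hasCompactSupport ?_ (HasCompactSupport.mul_right hcs.mul_left)
    have := transform_continuous hr
    fun_prop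
  · refine Continuous.integrable_of_hasCompactSupport (by fun_prop) ?_
    exact (h2.mul_right).mul_left

lemma fhat_split {φ : ℝ → ℂ} (h1 : Continuous φ) (h2 : HasCompactSupport φ) (σ x : ℝ) :
    fhat (fun t => (σ + t * Complex.I) * φ t) x =
      σ * fhat φ x + fhat (fun t => (t * Complex.I) * φ t) x := by
  rw [fhat, fhat, fhat, ← integral_const_mul, ← integral_add]
  · congr 1; ext t; ring
  · refine Continuous.integrable_of_hasCompactSupport (by fun_prop) ?_
    exact (h2.mul_right).mul_left
  · refine Continuous.integrable_of_hasCompactSupport (by fun_prop) ?_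
    exact HasCompactSupport.mul_right h2.mul_left

lemma h_measurable {h : ℝ → ℝ} (hm : Monotone fun w => Real.exp w * h w) : Measurable h := by
  have : h = fun w => Real.exp (-w) * (Real.exp w * h w) := by
    ext w; rw [← mul_assoc, ← Real.exp_add]; simp
  rw [this]
  exact (by fun_prop : Measurable fun w => Real.exp (-w)).mul hm.measurable

lemma h_bounded {h : ℝ → ℝ} (h0 : ∀ w, 0 ≤ h w) (hneg : ∀ w < 0, h w = 0)
    (hm : Monotone fun w => Real.exp w * h w) {y0 C : ℝ} (hC : ∀ y ≥ y0, h y ≤ C) :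
    ∃ B, ∀ y, h y ≤ B := by
  refine ⟨max C (Real.exp y0 * h y0), fun y => ?_⟩
  rcases le_total y0 y with hy | hy
  · exact (hC y hy).trans (le_max_left _ _)
  · refine le_trans ?_ (le_max_right _ _)
    rcases lt_or_ge y 0 with hy0 | hy0
    · rw [hneg y hy0]; exact mul_nonneg (Real.exp_pos _).le (h0 _)
    · refine le_trans ?_ (hm hy)
      exact le_mul_of_one_le_left (h0 y) (Real.one_le_exp hy0)

lemma r_bound {h : ℝ → ℝ} (h0 : ∀ w, 0 ≤ h w) (hneg : ∀ w < 0, h w = 0) {a B : ℝ} (ha : 0 ≤ a)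
    (hB : ∀ y, h y ≤ B) {δ : ℝ} (hδ : 0 ≤ δ) (w : ℝ) :
    |(h w - a * hvs w) * Real.exp (-δ * w)| ≤ B + a := by
  have hB0 : 0 ≤ B := (h0 0).trans (hB 0)
  rcases lt_or_ge w 0 with hw | hw
  · simp [hneg w hw, hvs, not_le.2 hw]; positivity
  · rw [abs_mul, abs_of_pos (Real.exp_pos _)]
    have e1 : Real.exp (-δ * w) ≤ 1 := Real.exp_le_one_iff.2 (by nlinarith)
    have e2 : |h w - a * hvs w| ≤ B + a := by
      simp only [hvs, hw, if_true, mul_one]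
      rw [abs_le]; constructor <;> linarith [h0 w, hB w]
    calc _ ≤ (B + a) * 1 := mul_le_mul e2 e1 (Real.exp_pos _).le (by positivity)
      _ = _ := mul_one _

lemma fwd {h : ℝ → ℝ} (h0 : ∀ w, 0 ≤ h w) (hneg : ∀ w < 0, h w = 0)
    (hm : Monotone fun w => Real.exp w * h w) {a : ℝ} (ha : 0 ≤ a) {F : ℂ → ℂ}
    (hi : ∀ σ > 1, Integrable (fun w => h w * Real.exp (-(σ - 1) * w)))
    (hF : ∀ s : ℂ, 1 < s.re → F s = s * ∫ w : ℝ, (h w : ℂ) * Complex.exp (-(s - 1) * w))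
    (hlim : Tendsto h atTop (𝓝 a)) :
    LocalPseudofunctionBoundary (fun s => F s - a / (s - 1)) Set.univ := by
  intro φ h1 h2 _
  obtain ⟨B, hB⟩ : ∃ B, ∀ y, h y ≤ B := by
    obtain ⟨y0, hy0⟩ := eventually_atTop.1 (hlim.eventually (eventually_le_nhds (lt_add_one a)))
    exact h_bounded h0 hneg hm hy0
  have hmeas := h_measurable hm
  have hs1 : ContDiff ℝ (⊤ : ℕ∞) (fun t : ℝ => ((t : ℂ) * Complex.I) * φ t) :=
    (Complex.ofRealCLM.contDiff.mul contDiff_const).mul h1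
  have hs2 : HasCompactSupport (fun t : ℝ => ((t : ℂ) * Complex.I) * φ t) := h2.mul_left
  have c1 := fhat_continuous h1 h2
  have c2 := fhat_continuous hs1 hs2
  have i1 := fhat_integrable h1 h2
  have i2 := fhat_integrable hs1 hs2
  set P := fhat φ
  set Q := fhat (fun t : ℝ => ((t : ℂ) * Complex.I) * φ t)
  have hum := hvs_measurable
  refine ⟨fun x => (∫ w : ℝ, ((h w - a * hvs w : ℝ) : ℂ) * (P (x + w) + Q (x + w))) + a * P x,
    fun x => ?_, ?_⟩
  · have hev : ∀ᶠ σ : ℝ in 𝓝[>] 1, 1 < σ ∧ σ < 2 := by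
      filter_upwards [self_mem_nhdsWithin, mem_nhdsWithin_of_mem_nhds (Iio_mem_nhds one_lt_two)]
        with σ h1 h2 using ⟨h1, h2⟩
    have : ∀ᶠ σ : ℝ in 𝓝[>] 1, (∫ w : ℝ, (((h w - a * hvs w) * Real.exp (-(σ - 1) * w) : ℝ) : ℂ) *
          (σ * P (x + w) + Q (x + w))) + a * P x = ∫ t : ℝ, (F (σ + t * Complex.I) - a / ((σ + t * Complex.I) - 1)) * φ t *
        Complex.exp (-(x * t) * Complex.I) := by
      filter_upwards [hev] with σ hσ
      rw [key hσ.1 a (hi σ hσ.1) hF h1.continuous h2]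
      simp only [fhat_split h1.continuous h2, P, Q]
    refine Tendsto.congr' this (Tendsto.add_const _ ?_)
    refine tendsto_integral_filter_of_dominated_convergence
      (fun w => (B + a) * (2 * ‖P (x + w)‖ + ‖Q (x + w)‖)) ?_ ?_ ?_ ?_
    · refine Eventually.of_forall fun σ => ?_
      exact (Measurable.mul (by fun_prop) (by fun_prop)).aestronglyMeasurable
    · filter_upwards [hev] with σ hσ
      refine Eventually.of_forall fun w => ?_
      rw [norm_mul, Complex.norm_real]
      refine mul_le_mul (r_bound h0 hneg ha hB (by linarith [hσ.1]) w) ?_ (norm_nonneg _)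
        (add_nonneg ((h0 0).trans (hB 0)) ha)
      refine (norm_add_le _ _).trans (add_le_add_left ?_ _)
      rw [norm_mul, Complex.norm_real, Real.norm_eq_abs, abs_of_pos (by linarith [hσ.1])]
      exact mul_le_mul_of_nonneg_right hσ.2.le (norm_nonneg _)
    · exact (((i1.comp_add_left x).norm.const_mul 2).add (i2.comp_add_left x).norm).const_mul _
    · refine Eventually.of_forall fun w => ?_
      have : Continuous fun σ : ℝ => (((h w - a * hvs w) * Real.exp (-(σ - 1) * w) : ℝ) : ℂ) *
          (σ * P (x + w) + Q (x + w)) := by fun_prop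
      have := (this.tendsto 1).mono_left (nhdsWithin_le_nhds (s := Ioi 1))
      simpa using this
  · have t1 : Tendsto (fun x => (a : ℂ) * P x) (cocompact ℝ) (𝓝 0) := by
      simpa using (fhat_tendsto φ).const_mul (a : ℂ)
    rw [show (0 : ℂ) = 0 + 0 by simp]
    refine Tendsto.add ?_ t1
    have e : ∀ x, (∫ w : ℝ, ((h w - a * hvs w : ℝ) : ℂ) * (P (x + w) + Q (x + w))) =
        ∫ v : ℝ, ((h (v - x) - a * hvs (v - x) : ℝ) : ℂ) * (P v + Q v) := by
      intro x
      rw [← integral_sub_right_eq_self _ x]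
      simp
    simp_rw [e]
    have hr0 : Tendsto (fun w => h w - a * hvs w) (cocompact ℝ) (𝓝 0) := by
      rw [cocompact_eq_atBot_atTop, tendsto_sup]
      constructor
      · refine tendsto_const_nhds.congr' ?_
        filter_upwards [eventually_lt_atBot 0] with w hw
        simp [hneg w hw, hvs, not_le.2 hw]
      · rw [← sub_self a]
        refine (hlim.sub_const a).congr' ?_
        filter_upwards [eventually_ge_atTop 0] with w hw
        simp [hvs, hw]
    have : (cocompact ℝ).IsCountablyGenerated := by
      rw [cocompact_eq_atBot_atTop]; infer_instance
    rw [show (0 : ℂ) = ∫ v : ℝ, (0 : ℂ) * (P v + Q v) by simp]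
    refine tendsto_integral_filter_of_dominated_convergence
      (fun v => (B + a) * ‖P v + Q v‖) ?_ ?_ ((i1.add i2).norm.const_mul _) ?_
    · refine Eventually.of_forall fun σ => ?_
      exact (Measurable.mul (by fun_prop) (by fun_prop)).aestronglyMeasurable
    · refine Eventually.of_forall fun x => Eventually.of_forall fun w => ?_
      rw [norm_mul, Complex.norm_real]
      refine mul_le_mul_of_nonneg_right ?_ (norm_nonneg _)
      simpa using r_bound h0 hneg ha hB le_rfl (w - x)
    · refine Eventually.of_forall fun v => Tendsto.mul_const _ ?_
      have : Tendsto (fun x => v - x) (cocompact ℝ) (cocompact ℝ) :=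
        (Homeomorph.subLeft v).isClosedEmbedding.tendsto_cocompact
      exact_mod_cast (Complex.continuous_ofReal.tendsto _).comp (hr0.comp this)
lemma window_low {h k : ℝ → ℝ} (h0 : ∀ w, 0 ≤ h w) (hm : Monotone fun w => Real.exp w * h w)
    (hk0 : ∀ x, 0 ≤ k x) (hki : Integrable k) {δ η y m : ℝ} (hδ : 0 ≤ δ) (hη : 0 < η)
    (hmk : m ≤ ∫ x in Icc (-η) η, k x)
    (hintg : Integrable fun w => h w * Real.exp (-δ * w) * k (-y + w)) :
    h (y - η) * Real.exp (-2 * η) * Real.exp (-δ * (y + η)) * m ≤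
      ∫ w, h w * Real.exp (-δ * w) * k (-y + w) := by
  set c := h (y - η) * Real.exp (-2 * η) * Real.exp (-δ * (y + η))
  have hc : 0 ≤ c := mul_nonneg (mul_nonneg (h0 _) (Real.exp_pos _).le) (Real.exp_pos _).le
  have hpt : ∀ w, -η ≤ -y + w → -y + w ≤ η → c ≤ h w * Real.exp (-δ * w) := by
    intro w hw1 hw2
    refine mul_le_mul ?_ (Real.exp_le_exp.2 (by nlinarith)) (Real.exp_pos _).le (h0 _)
    have h1 : Real.exp (y - η) * h (y - η) ≤ Real.exp w * h w := hm (by linarith)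
    have h2 : Real.exp w ≤ Real.exp (y + η) := Real.exp_le_exp.2 (by linarith)
    have h3 : Real.exp (y - η) = Real.exp (y + η) * Real.exp (-2 * η) := by
      rw [← Real.exp_add]; congr 1; ring
    have h4 : Real.exp (y + η) * (h (y - η) * Real.exp (-2 * η)) ≤ Real.exp (y + η) * h w := by
      calc _ = Real.exp (y - η) * h (y - η) := by rw [h3]; ring
        _ ≤ Real.exp w * h w := h1
        _ ≤ _ := mul_le_mul_of_nonneg_right h2 (h0 w)
    exact le_of_mul_le_mul_left h4 (Real.exp_pos _)
  calc c * m ≤ c * ∫ x in Icc (-η) η, k x := mul_le_mul_of_nonneg_left hmk hc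
    _ = ∫ w, (Icc (-η) η).indicator (fun v => c * k v) (-y + w) := by
      rw [integral_add_left_eq_self, integral_indicator measurableSet_Icc, integral_const_mul]
    _ ≤ _ := by
      refine integral_mono (Integrable.comp_add_left (((hki.const_mul c)).indicator measurableSet_Icc) _) hintg fun w => ?_
      by_cases hw : -y + w ∈ Icc (-η) η
      · simp only [indicator_of_mem hw]
        exact mul_le_mul_of_nonneg_right (hpt w hw.1 hw.2) (hk0 _)
      · simp only [indicator_of_notMem hw]
        exact mul_nonneg (mul_nonneg (h0 _) (Real.exp_pos _).le) (hk0 _)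

lemma window_high {h k : ℝ → ℝ} (h0 : ∀ w, 0 ≤ h w) (hm : Monotone fun w => Real.exp w * h w)
    (hk0 : ∀ x, 0 ≤ k x) (hki : Integrable k) (hk1 : ∫ x, k x = 1) {η y ε B : ℝ} (hη : 0 < η)
    (hB : ∀ w, h w ≤ B)
    (hmk : 1 - ε ≤ ∫ x in Icc (-η) η, k x) :
    ∫ w, h w * k (-y + w) ≤ h (y + η) * Real.exp (2 * η) + B * ε := by
  have hB0 : 0 ≤ B := (h0 0).trans (hB 0)
  have hmeas := h_measurable hm
  set c := h (y + η) * Real.exp (2 * η)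
  have hc : 0 ≤ c := mul_nonneg (h0 _) (Real.exp_pos _).le
  have hpt : ∀ w, -η ≤ -y + w → -y + w ≤ η → h w ≤ c := by
    intro w hw1 hw2
    have h1 : Real.exp w * h w ≤ Real.exp (y + η) * h (y + η) := hm (by linarith)
    have h2 : Real.exp (y - η) ≤ Real.exp w := Real.exp_le_exp.2 (by linarith)
    have h3 : Real.exp (y + η) = Real.exp (y - η) * Real.exp (2 * η) := by
      rw [← Real.exp_add]; congr 1; ring
    have h4 : Real.exp (y - η) * h w ≤ Real.exp (y - η) * c := by
      calc _ ≤ Real.exp w * h w := mul_le_mul_of_nonneg_right h2 (h0 w)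
        _ ≤ _ := h1
        _ = _ := by rw [h3]; ring
    exact le_of_mul_le_mul_left h4 (Real.exp_pos _)
  have hI : Integrable ((Icc (-η) η).indicator k) := hki.indicator measurableSet_Icc
  have hII : Integrable fun v => c * k v + B * (k v - (Icc (-η) η).indicator k v) :=
    (hki.const_mul c).add ((hki.sub hI).const_mul B)
  calc ∫ w, h w * k (-y + w)
      ≤ ∫ w, (fun v => c * k v + B * (k v - (Icc (-η) η).indicator k v)) (-y + w) := by
        refine integral_mono ?_ (hII.comp_add_left (-y)) fun w => ?_
        · exact (hki.comp_add_left (-y)).bdd_mul (c := B) hmeas.aestronglyMeasurable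
            (Eventually.of_forall fun w => by
              rw [Real.norm_eq_abs, abs_of_nonneg (h0 w)]; exact hB w)
        · simp only
          by_cases hw : -y + w ∈ Icc (-η) η
          · rw [indicator_of_mem hw]
            have := mul_le_mul_of_nonneg_right (hpt w hw.1 hw.2) (hk0 (-y + w))
            linarith
          · rw [indicator_of_notMem hw]
            have := mul_le_mul_of_nonneg_right (hB w) (hk0 (-y + w))
            have := mul_nonneg hc (hk0 (-y + w))
            linarith
    _ = c * 1 + B * (1 - ∫ x in Icc (-η) η, k x) := by
        rw [integral_add_left_eq_self (fun v => c * k v + B * (k v - (Icc (-η) η).indicator k v)),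
          integral_add (hki.const_mul c) (Integrable.const_mul (hki.sub hI : Integrable fun v => k v - (Icc (-η) η).indicator k v) B), integral_const_mul,
          integral_const_mul, integral_sub hki hI, hk1, integral_indicator measurableSet_Icc]
    _ ≤ _ := by
        have := mul_le_mul_of_nonneg_left (show 1 - ∫ x in Icc (-η) η, k x ≤ ε by linarith) hB0
        linarith

lemma bwd1 {h : ℝ → ℝ} {a : ℝ} {F : ℂ → ℂ}
    (hi : ∀ σ > 1, Integrable (fun w => h w * Real.exp (-(σ - 1) * w)))
    (hF : ∀ s : ℂ, 1 < s.re → F s = s * ∫ w : ℝ, (h w : ℂ) * Complex.exp (-(s - 1) * w))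
    (hlpb : LocalPseudofunctionBoundary (fun s => F s - a / (s - 1)) Set.univ)
    {φ : ℝ → ℂ} (h1 : ContDiff ℝ (⊤ : ℕ∞) φ) (h2 : HasCompactSupport φ)
    {k : ℝ → ℝ} (hk : ∀ x, fhat φ x = k x) (hk0 : ∀ x, 0 ≤ k x) :
    ∃ L g : ℝ → ℝ, (∀ x, 0 ≤ L x) ∧ Integrable L ∧ Continuous L ∧ (∃ C, ∀ x, L x ≤ C) ∧
      Tendsto g (cocompact ℝ) (𝓝 0) ∧
      ∀ x, Tendsto (fun σ : ℝ => ∫ w, (h w - a * hvs w) * Real.exp (-(σ - 1) * w) *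
        (k (x + w) + (σ - 1) * L (x + w))) (𝓝[>] 1) (𝓝 (g x)) := by
  have hne : ∀ t : ℝ, (1 : ℂ) + t * Complex.I ≠ 0 := by
    intro t h0
    have := congrArg Complex.re h0
    simp at this
  set ψ : ℝ → ℂ := fun t => (1 + t * Complex.I)⁻¹ * φ t with hψ
  have hψ1 : ContDiff ℝ (⊤ : ℕ∞) ψ := by
    refine ContDiff.mul (ContDiff.inv ?_ hne) h1
    exact contDiff_const.add (Complex.ofRealCLM.contDiff.mul contDiff_const)
  have hψ2 : HasCompactSupport ψ := h2.mul_left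
  set L : ℝ → ℝ := fun x => ∫ w, hvs w * Real.exp (-1 * w) * k (x + w)
  have hL : ∀ x, fhat ψ x = L x := by
    intro x
    have hq : Integrable (fun w : ℝ => ((hvs w * Real.exp (-1 * w) : ℝ) : ℂ)) :=
      (hvs_exp_integrable one_pos).ofReal
    have e := fhat_fubini hq (h1.continuous.integrable_of_hasCompactSupport h2) x
    simp_rw [hvs_transform one_pos, hk] at e
    have e2 : fhat ψ x = ∫ w : ℝ, ((hvs w * Real.exp (-1 * w) : ℝ) : ℂ) * (k (x + w) : ℂ) := by
      rw [← e, fhat]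
      congr 1; ext t; simp [hψ]
    rw [e2, ← integral_complex_ofReal]
    congr 1; ext w; push_cast; rfl
  have hL' : L = fun x => (fhat ψ x).re := by ext x; rw [hL x]; simp
  have hLc : Continuous L := by
    rw [hL']; exact Complex.continuous_re.comp (fhat_continuous hψ1 hψ2)
  have hLi : Integrable L := by
    rw [hL']; exact (fhat_integrable hψ1 hψ2).re
  have hLt : Tendsto L (cocompact ℝ) (𝓝 0) := by
    rw [hL']; simpa [Function.comp_def] using (Complex.continuous_re.tendsto 0).comp (fhat_tendsto ψ)
  have hLb : ∃ C, ∀ x, L x ≤ C := by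
    refine ⟨∫ t, ‖ψ t‖, fun x => ?_⟩
    rw [hL']
    refine (Complex.re_le_norm _).trans ((norm_integral_le_integral_norm _).trans (le_of_eq ?_))
    congr 1; ext t
    rw [norm_mul, Complex.norm_exp]; simp
  obtain ⟨g, hg1, hg2⟩ := hlpb ψ hψ1 hψ2 (subset_univ _)
  refine ⟨L, fun x => (g x).re - a * L x, fun x => ?_, hLi, hLc, hLb, ?_, fun x => ?_⟩
  · refine integral_nonneg fun w => mul_nonneg (mul_nonneg ?_ (Real.exp_pos _).le) (hk0 _)
    simp only [hvs]; split_ifs <;> norm_num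
  · have := ((Complex.continuous_re.tendsto 0).comp hg2).sub (hLt.const_mul a)
    simpa using this
  · have := ((Complex.continuous_re.tendsto _).comp (hg1 x)).sub_const (a * L x)
    refine this.congr' ?_
    filter_upwards [self_mem_nhdsWithin] with σ hσ
    have hσ : 1 < σ := hσ
    simp only [Function.comp]
    rw [key hσ a (hi σ hσ) hF hψ1.continuous hψ2]
    have e1 : ∀ y, fhat (fun t => (σ + t * Complex.I) * ψ t) y =
        ((k y + (σ - 1) * L y : ℝ) : ℂ) := by
      intro y
      have : (fun t : ℝ => ((σ : ℂ) + t * Complex.I) * ψ t) =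
          fun t => φ t + ((σ - 1 : ℝ) : ℂ) * ψ t := by
        ext t
        simp only [hψ]
        have := hne t
        push_cast
        field_simp
        ring
      rw [this]
      have i1 : Integrable (fun t : ℝ => φ t * Complex.exp (-(y * t) * Complex.I)) := by
        have := h1.continuous
        exact Continuous.integrable_of_hasCompactSupport (by fun_prop) h2.mul_right
      have i2 : Integrable (fun t : ℝ => ((σ - 1 : ℝ) : ℂ) * ψ t * Complex.exp (-(y * t) * Complex.I)) := by
        have := hψ1.continuous
        exact Continuous.integrable_of_hasCompactSupport (by fun_prop)
          (HasCompactSupport.mul_right hψ2.mul_left)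
      have e3 := fhat_const_mul ψ ((σ - 1 : ℝ) : ℂ) y
      rw [hL] at e3
      have e4 := hk y
      rw [fhat] at e3 e4 ⊢
      simp_rw [add_mul]
      rw [integral_add i1 i2, e3, e4]
      push_cast; rfl
    simp_rw [e1, hL, ← Complex.ofReal_mul]
    rw [integral_complex_ofReal, ← Complex.ofReal_add, Complex.ofReal_re]
    ring

lemma bwd2 {h : ℝ → ℝ} (h0 : ∀ w, 0 ≤ h w) (hneg : ∀ w < 0, h w = 0)
    (hm : Monotone fun w => Real.exp w * h w) {a : ℝ} (ha : 0 ≤ a) {F : ℂ → ℂ}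
    (hi : ∀ σ > 1, Integrable (fun w => h w * Real.exp (-(σ - 1) * w)))
    (hF : ∀ s : ℂ, 1 < s.re → F s = s * ∫ w : ℝ, (h w : ℂ) * Complex.exp (-(s - 1) * w))
    (hlpb : LocalPseudofunctionBoundary (fun s => F s - a / (s - 1)) Set.univ)
    {φ : ℝ → ℂ} (h1 : ContDiff ℝ (⊤ : ℕ∞) φ) (h2 : HasCompactSupport φ)
    {k : ℝ → ℝ} (hk : ∀ x, fhat φ x = k x) (hk0 : ∀ x, 0 ≤ k x) (hki : Integrable k)
    (hk1 : ∫ x, k x = 1) {η m : ℝ} (hη : 0 < η) (hm0 : 0 < m)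
    (hmk : m ≤ ∫ x in Icc (-η) η, k x) :
    (∃ B, ∀ y, h y ≤ B) ∧
      Tendsto (fun y => ∫ w, h w * k (-y + w)) atTop (𝓝 a) := by
  obtain ⟨L, g, hL0, hLi, hLc, ⟨C, hC⟩, hg, hJ⟩ := bwd1 hi hF hlpb h1 h2 hk hk0
  have hmeas := h_measurable hm
  have hum := hvs_measurable
  have hu0 : ∀ w, 0 ≤ hvs w := fun w => by simp only [hvs]; split_ifs <;> norm_num
  have hu1 : ∀ w, hvs w ≤ 1 := fun w => by simp only [hvs]; split_ifs <;> norm_num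
  have hk' : k = fun x => (fhat φ x).re := by ext x; rw [hk x]; simp
  have hkc : Continuous k := by
    rw [hk']; exact Complex.continuous_re.comp (fhat_continuous h1 h2)
  obtain ⟨D, hD⟩ : ∃ C, ∀ x, k x ≤ C := by
    refine ⟨∫ t, ‖φ t‖, fun x => ?_⟩
    rw [hk']
    refine (Complex.re_le_norm _).trans ((norm_integral_le_integral_norm _).trans (le_of_eq ?_))
    congr 1; ext t
    rw [norm_mul, Complex.norm_exp]; simp
  have hneg' : Tendsto (fun y : ℝ => -y) atTop (cocompact ℝ) :=
    tendsto_neg_atTop_atBot.mono_right (by rw [cocompact_eq_atBot_atTop]; exact le_sup_left)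
  -- pointwise bound
  have hbd : ∀ y, h (y - η) * Real.exp (-2 * η) * m ≤ g (-y) + a := by
    intro y
    have t1 : Tendsto (fun σ : ℝ => h (y - η) * Real.exp (-2 * η) * Real.exp (-(σ - 1) * (y + η)) * m)
        (𝓝[>] 1) (𝓝 (h (y - η) * Real.exp (-2 * η) * m)) := by
      have : Continuous (fun σ : ℝ => h (y - η) * Real.exp (-2 * η) * Real.exp (-(σ - 1) * (y + η)) * m) := by
        fun_prop
      simpa using (this.tendsto 1).mono_left (nhdsWithin_le_nhds (s := Ioi 1))
    have t2 : Tendsto (fun σ : ℝ => a * (1 + (σ - 1) * ∫ x, L x)) (𝓝[>] 1) (𝓝 a) := by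
      have : Continuous (fun σ : ℝ => a * (1 + (σ - 1) * ∫ x, L x)) := by fun_prop
      simpa using (this.tendsto 1).mono_left (nhdsWithin_le_nhds (s := Ioi 1))
    refine le_of_tendsto_of_tendsto t1 ((hJ (-y)).add t2) ?_
    filter_upwards [self_mem_nhdsWithin] with σ hσ
    have hσ : 1 < σ := hσ
    have hδ : 0 < σ - 1 := by linarith
    have ik : Integrable fun w => k (-y + w) := hki.comp_add_left (-y)
    have iL : Integrable fun w => L (-y + w) := hLi.comp_add_left (-y)
    have iM : Integrable fun w => k (-y + w) + (σ - 1) * L (-y + w) := ik.add (iL.const_mul _)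
    have i1 : Integrable fun w => h w * Real.exp (-(σ - 1) * w) * k (-y + w) := by
      refine (hi σ hσ).mul_bdd (c := D) (by fun_prop) (Eventually.of_forall fun w => ?_)
      rw [Real.norm_eq_abs, abs_of_nonneg (hk0 _)]; exact hD _
    have i2 : Integrable fun w => h w * Real.exp (-(σ - 1) * w) * L (-y + w) := by
      refine (hi σ hσ).mul_bdd (c := C) (by fun_prop) (Eventually.of_forall fun w => ?_)
      rw [Real.norm_eq_abs, abs_of_nonneg (hL0 _)]; exact hC _
    have hle1 : ∀ w, hvs w * Real.exp (-(σ - 1) * w) ≤ 1 := by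
      intro w
      rcases lt_or_ge w 0 with hw | hw
      · simp [hvs, not_le.2 hw]
      · simp only [hvs, hw, if_true, one_mul]
        exact Real.exp_le_one_iff.2 (by nlinarith)
    have hge0 : ∀ w, 0 ≤ hvs w * Real.exp (-(σ - 1) * w) := fun w =>
      mul_nonneg (hu0 w) (Real.exp_pos _).le
    have i3 : Integrable fun w => hvs w * Real.exp (-(σ - 1) * w) * (k (-y + w) + (σ - 1) * L (-y + w)) := by
      refine iM.bdd_mul (c := 1) (by fun_prop) (Eventually.of_forall fun w => ?_)
      rw [Real.norm_eq_abs, abs_of_nonneg (hge0 w)]; exact hle1 w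
    have e : ∫ w, (h w - a * hvs w) * Real.exp (-(σ - 1) * w) * (k (-y + w) + (σ - 1) * L (-y + w))
        = (∫ w, h w * Real.exp (-(σ - 1) * w) * k (-y + w)) +
          (σ - 1) * (∫ w, h w * Real.exp (-(σ - 1) * w) * L (-y + w)) -
          a * ∫ w, hvs w * Real.exp (-(σ - 1) * w) * (k (-y + w) + (σ - 1) * L (-y + w)) := by
      rw [← integral_const_mul, ← integral_const_mul, ← integral_add i1 (i2.const_mul _),
        ← integral_sub (f := fun w => h w * Real.exp (-(σ - 1) * w) * k (-y + w) +
          (σ - 1) * (h w * Real.exp (-(σ - 1) * w) * L (-y + w))) (i1.add (i2.const_mul _)) (i3.const_mul _)]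
      congr 1; ext w; ring
    have p1 := window_low h0 hm hk0 hki (y := y) hδ.le hη hmk i1
    have p2 : 0 ≤ ∫ w, h w * Real.exp (-(σ - 1) * w) * L (-y + w) :=
      integral_nonneg fun w => mul_nonneg (mul_nonneg (h0 _) (Real.exp_pos _).le) (hL0 _)
    have p3 : ∫ w, hvs w * Real.exp (-(σ - 1) * w) * (k (-y + w) + (σ - 1) * L (-y + w)) ≤
        1 + (σ - 1) * ∫ x, L x := by
      calc _ ≤ ∫ w, (k (-y + w) + (σ - 1) * L (-y + w)) := by
            refine integral_mono i3 iM fun w => ?_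
            exact mul_le_of_le_one_left (add_nonneg (hk0 _) (mul_nonneg hδ.le (hL0 _))) (hle1 w)
        _ = _ := by
            rw [integral_add ik (iL.const_mul _), integral_const_mul,
              integral_add_left_eq_self k, integral_add_left_eq_self L, hk1]
    rw [e]
    have p4 := mul_le_mul_of_nonneg_left p3 ha
    have p5 := mul_nonneg hδ.le p2
    linarith
  obtain ⟨B, hB⟩ : ∃ B, ∀ y, h y ≤ B := by
    obtain ⟨y0, hy0⟩ := eventually_atTop.1
      ((hg.comp hneg').eventually (eventually_le_nhds (zero_lt_one' ℝ)))
    refine h_bounded h0 hneg hm (y0 := y0) (C := (1 + a) / (Real.exp (-2 * η) * m)) fun y hy => ?_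
    have h3 := hbd (y + η)
    have h4 := hy0 (y + η) (by linarith)
    simp only [Function.comp] at h4
    rw [add_sub_cancel_right] at h3
    rw [le_div_iff₀ (by positivity)]
    linarith
  have hB0 : 0 ≤ B := (h0 0).trans (hB 0)
  refine ⟨⟨B, hB⟩, ?_⟩
  have hgx : ∀ x, g x = ∫ w, (h w - a * hvs w) * k (x + w) := by
    intro x
    refine tendsto_nhds_unique (hJ x) ?_
    refine tendsto_integral_filter_of_dominated_convergence
      (fun w => (B + a) * (k (x + w) + L (x + w))) ?_ ?_ ?_ ?_
    · refine Eventually.of_forall fun σ => ?_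
      have := hkc.measurable; have := hLc.measurable
      exact (Measurable.mul (by fun_prop) (by fun_prop)).aestronglyMeasurable
    · filter_upwards [self_mem_nhdsWithin, mem_nhdsWithin_of_mem_nhds (Iio_mem_nhds one_lt_two)]
        with σ hσ hσ2
      have hσ : 1 < σ := hσ
      have hσ2 : σ < 2 := hσ2
      refine Eventually.of_forall fun w => ?_
      have hδ : 0 < σ - 1 := by linarith
      have hn : 0 ≤ k (x + w) + (σ - 1) * L (x + w) :=
        add_nonneg (hk0 _) (mul_nonneg hδ.le (hL0 _))
      rw [norm_mul, Real.norm_eq_abs, Real.norm_eq_abs, abs_of_nonneg hn]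
      refine mul_le_mul (r_bound h0 hneg ha hB hδ.le w) ?_ hn (by positivity)
      have := mul_le_of_le_one_left (hL0 (x + w)) (show σ - 1 ≤ 1 by linarith)
      linarith
    · exact ((hki.comp_add_left x).add (hLi.comp_add_left x)).const_mul _
    · refine Eventually.of_forall fun w => ?_
      have : Continuous fun σ : ℝ => (h w - a * hvs w) * Real.exp (-(σ - 1) * w) *
        (k (x + w) + (σ - 1) * L (x + w)) := by fun_prop
      simpa using (this.tendsto 1).mono_left (nhdsWithin_le_nhds (s := Ioi 1))
  have t1 : Tendsto (fun y => ∫ w, hvs w * k (-y + w)) atTop (𝓝 1) := by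
    have e : ∀ y, ∫ w, hvs w * k (-y + w) = ∫ v, hvs (v + y) * k v := by
      intro y
      rw [← integral_add_left_eq_self (fun v => hvs (v + y) * k v) (-y)]
      simp
    simp_rw [e]
    rw [← hk1]
    refine tendsto_integral_filter_of_dominated_convergence k ?_ ?_ hki ?_
    · refine Eventually.of_forall fun σ => ?_
      have := hkc.measurable
      exact (Measurable.mul (by fun_prop) (by fun_prop)).aestronglyMeasurable
    · refine Eventually.of_forall fun y => Eventually.of_forall fun w => ?_
      rw [norm_mul, Real.norm_eq_abs, Real.norm_eq_abs, abs_of_nonneg (hk0 _), abs_of_nonneg (hu0 _)]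
      exact mul_le_of_le_one_left (hk0 _) (hu1 _)
    · refine Eventually.of_forall fun v => ?_
      refine tendsto_const_nhds.congr' ?_
      filter_upwards [eventually_ge_atTop (-v)] with y hy
      simp [hvs, show 0 ≤ v + y by linarith]
  have t2 := (hg.comp hneg').add (t1.const_mul a)
  rw [zero_add, mul_one] at t2
  refine t2.congr fun y => ?_
  have ik : Integrable fun w => k (-y + w) := hki.comp_add_left (-y)
  simp only [Function.comp]
  rw [hgx, ← integral_const_mul, ← integral_add]
  · congr 1; ext w; ring
  · refine ik.bdd_mul (c := B + a) (by fun_prop) (Eventually.of_forall fun w => ?_)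
    simpa using r_bound h0 hneg ha hB le_rfl w
  · refine Integrable.const_mul (ik.bdd_mul (c := 1) (by fun_prop) (Eventually.of_forall fun w => ?_)) a
    rw [Real.norm_eq_abs, abs_of_nonneg (hu0 w)]; exact hu1 w

lemma bwd {h : ℝ → ℝ} (h0 : ∀ w, 0 ≤ h w) (hneg : ∀ w < 0, h w = 0)
    (hm : Monotone fun w => Real.exp w * h w) {a : ℝ} (ha : 0 ≤ a) {F : ℂ → ℂ}
    (hi : ∀ σ > 1, Integrable (fun w => h w * Real.exp (-(σ - 1) * w)))
    (hF : ∀ s : ℂ, 1 < s.re → F s = s * ∫ w : ℝ, (h w : ℂ) * Complex.exp (-(s - 1) * w))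
    (hlpb : LocalPseudofunctionBoundary (fun s => F s - a / (s - 1)) Set.univ) :
    Tendsto h atTop (𝓝 a) := by
  have main : ∀ ε > 0, ε < 1 → (∃ B, ∀ y, h y ≤ B) ∧ ∃ I : ℝ → ℝ, Tendsto I atTop (𝓝 a) ∧
      (∀ y, h (y - ε) * Real.exp (-2 * ε) * (1 - ε) ≤ I y) ∧
      (∀ B, (∀ y, h y ≤ B) → ∀ y, I y ≤ h (y + ε) * Real.exp (2 * ε) + B * ε) := by
    intro ε hε hε1
    obtain ⟨φ, h1, h2, k, hk, hk0, hki, hk1, hmk⟩ := exists_kernel hε hε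
    obtain ⟨⟨B, hB⟩, hI⟩ := bwd2 h0 hneg hm ha hi hF hlpb h1 h2 hk hk0 hki hk1 hε
      (by linarith) hmk
    refine ⟨⟨B, hB⟩, _, hI, fun y => ?_, fun B' hB' y => window_high h0 hm hk0 hki hk1 hε hB' hmk⟩
    have hmeas := h_measurable hm
    have := window_low h0 hm hk0 hki (y := y) (δ := 0) le_rfl hε hmk (by
      simp only [neg_zero, zero_mul, Real.exp_zero, mul_one]
      refine (hki.comp_add_left (-y)).bdd_mul (c := B) (by fun_prop) (Eventually.of_forall fun w => ?_)
      rw [Real.norm_eq_abs, abs_of_nonneg (h0 w)]; exact hB w)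
    simpa using this
  obtain ⟨B, hB⟩ := (main (1 / 2) (by norm_num) (by norm_num)).1
  rw [tendsto_order]
  constructor
  · intro b hb
    have ht : Tendsto (fun ε : ℝ => (a - ε - B * ε) * Real.exp (-2 * ε)) (𝓝[>] 0) (𝓝 a) := by
      have : Continuous (fun ε : ℝ => (a - ε - B * ε) * Real.exp (-2 * ε)) := by fun_prop
      simpa using (this.tendsto 0).mono_left (nhdsWithin_le_nhds (s := Ioi 0))
    obtain ⟨ε, ⟨hε1, hε2⟩, hε3⟩ := ((ht.eventually (lt_mem_nhds hb)).and
      (mem_nhdsWithin_of_mem_nhds (Iio_mem_nhds (zero_lt_one' ℝ)))|>.and self_mem_nhdsWithin).exists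
    have hε3 : 0 < ε := hε3
    obtain ⟨-, I, hI, -, hI2⟩ := main ε hε3 hε2
    obtain ⟨y0, hy0⟩ := eventually_atTop.1 (hI.eventually (lt_mem_nhds (show a - ε < a by linarith)))
    filter_upwards [eventually_ge_atTop (y0 + ε)] with y hy
    have q1 := hy0 (y - ε) (by linarith)
    have q2 := hI2 B hB (y - ε)
    rw [sub_add_cancel] at q2
    refine hε1.trans_le ?_
    have q3 : a - ε - B * ε ≤ h y * Real.exp (2 * ε) := by linarith
    calc _ ≤ h y * Real.exp (2 * ε) * Real.exp (-2 * ε) :=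
          mul_le_mul_of_nonneg_right q3 (Real.exp_pos _).le
      _ = h y := by rw [mul_assoc, ← Real.exp_add]; simp
  · intro b hb
    have ht : Tendsto (fun ε : ℝ => (a + ε) / (Real.exp (-2 * ε) * (1 - ε))) (𝓝[>] 0) (𝓝 a) := by
      have : ContinuousAt (fun ε : ℝ => (a + ε) / (Real.exp (-2 * ε) * (1 - ε))) 0 := by
        refine ContinuousAt.div (by fun_prop) (by fun_prop) (by simp)
      simpa using this.tendsto.mono_left (nhdsWithin_le_nhds (s := Ioi 0))
    obtain ⟨ε, ⟨hε1, hε2⟩, hε3⟩ := ((ht.eventually (gt_mem_nhds hb)).and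
      (mem_nhdsWithin_of_mem_nhds (Iio_mem_nhds (zero_lt_one' ℝ)))|>.and self_mem_nhdsWithin).exists
    have hε3 : 0 < ε := hε3
    have hε2 : ε < 1 := hε2
    obtain ⟨-, I, hI, hI1, -⟩ := main ε hε3 hε2
    obtain ⟨y0, hy0⟩ := eventually_atTop.1 (hI.eventually (gt_mem_nhds (show a < a + ε by linarith)))
    filter_upwards [eventually_ge_atTop y0] with y hy
    have q1 := hy0 (y + ε) (by linarith)
    have q2 := hI1 (y + ε)
    rw [add_sub_cancel_right] at q2
    refine lt_of_le_of_lt ?_ hε1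
    rw [le_div_iff₀ (mul_pos (Real.exp_pos _) (by linarith))]
    linarith
lemma stj_inner {s : ℂ} (hs : 1 < s.re) {u : ℝ} (hu : 1 ≤ u) :
    Integrable (fun w : ℝ => if u ≤ Real.exp w then Complex.exp (-s * w) else 0) ∧
    ∫ w : ℝ, (if u ≤ Real.exp w then Complex.exp (-s * w) else 0) = (u : ℂ) ^ (-s) / s ∧
    ∫ w : ℝ, ‖(if u ≤ Real.exp w then Complex.exp (-s * w) else 0)‖ = ‖(u : ℂ) ^ (-s)‖ / s.re := by
  have hu0 : 0 < u := by linarith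
  have e : (fun w : ℝ => if u ≤ Real.exp w then Complex.exp (-s * w) else 0) =
      (Ici (Real.log u)).indicator (fun w : ℝ => Complex.exp (-s * w)) := by
    ext w
    simp only [indicator_apply, mem_Ici, Real.log_le_iff_le_exp hu0]
  have hs' : (-s).re < 0 := by simp; linarith
  have hs0 : s ≠ 0 := by rintro rfl; simp at hs; linarith
  refine ⟨?_, ?_, ?_⟩
  · rw [e, integrable_indicator_iff measurableSet_Ici, integrableOn_Ici_iff_integrableOn_Ioi]
    exact integrableOn_exp_mul_complex_Ioi hs' _
  · rw [e, integral_indicator measurableSet_Ici, integral_Ici_eq_integral_Ioi,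
      integral_exp_mul_complex_Ioi hs', Complex.cpow_def_of_ne_zero (by exact_mod_cast hu0.ne'),
      ← Complex.ofReal_log hu0.le, mul_comm]
    field_simp
  · have e2 : (fun w : ℝ => ‖(if u ≤ Real.exp w then Complex.exp (-s * w) else 0)‖) =
      (Ici (Real.log u)).indicator (fun w : ℝ => Real.exp (-s.re * w)) := by
      ext w
      simp only [indicator_apply, mem_Ici, Real.log_le_iff_le_exp hu0]
      split_ifs
      · rw [Complex.norm_exp]; simp
      · simp
    rw [e2, integral_indicator measurableSet_Ici, integral_Ici_eq_integral_Ioi,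
      integral_exp_mul_Ioi (by simpa using hs'), Complex.norm_cpow_eq_rpow_re_of_pos hu0,
      Real.rpow_def_of_pos hu0, Complex.neg_re, mul_comm (Real.log u)]
    rw [neg_div_neg_eq]

lemma stj_measure (N : StieltjesFunction ℝ) (hN : ∀ x < 1, N x = 0) (x : ℝ) :
    (N.measure.restrict (Ici 1)) (Iic x) = ENNReal.ofReal (N x) := by
  rw [Measure.restrict_apply measurableSet_Iic]
  have ht : Tendsto N (𝓝[<] 1) (𝓝 0) :=
    tendsto_const_nhds.congr' (by filter_upwards [self_mem_nhdsWithin] with x hx using (hN x hx).symm)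
  have hl : Function.leftLim N 1 = 0 := leftLim_eq_of_tendsto ht
  rw [inter_comm, Ici_inter_Iic, N.measure_Icc, hl, sub_zero]

lemma stj (N : StieltjesFunction ℝ) (hN : ∀ x < 1, N x = 0) {s : ℂ} (hs : 1 < s.re) :
    (IntegrableOn (fun u : ℝ => (u : ℂ) ^ (-s)) (Ici 1) N.measure ↔
      Integrable (fun w => N (Real.exp w) * Real.exp (-s.re * w))) ∧
    (IntegrableOn (fun u : ℝ => (u : ℂ) ^ (-s)) (Ici 1) N.measure →
      ∫ u in Ici (1 : ℝ), (u : ℂ) ^ (-s) ∂N.measure =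
        s * ∫ w : ℝ, (N (Real.exp w) : ℂ) * Complex.exp (-s * w)) := by
  have hN0 : ∀ x, 0 ≤ N x := by
    intro x
    have h1 : N (min x 0) = 0 := hN _ (lt_of_le_of_lt (min_le_right _ _) one_pos)
    rw [← h1]; exact N.mono (min_le_left _ _)
  set μ := N.measure.restrict (Ici 1) with hμ
  have hs0 : s ≠ 0 := by rintro rfl; simp at hs; linarith
  have hmeas : Measurable (Function.uncurry fun (u w : ℝ) =>
      if u ≤ Real.exp w then Complex.exp (-s * w) else 0) := by
    refine Measurable.ite ?_ (by fun_prop) measurable_const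
    exact measurableSet_le (by fun_prop) (by fun_prop)
  have hae : ∀ᵐ u ∂μ, 1 ≤ u := ae_restrict_mem measurableSet_Ici
  have hcm : Measurable fun u : ℝ => (u : ℂ) ^ (-s) := by fun_prop
  have A : Integrable (Function.uncurry fun (u w : ℝ) =>
      if u ≤ Real.exp w then Complex.exp (-s * w) else 0) (μ.prod volume) ↔
      Integrable (fun u : ℝ => (u : ℂ) ^ (-s)) μ := by
    rw [integrable_prod_iff hmeas.aestronglyMeasurable]
    have e : (fun u : ℝ => ∫ w : ℝ, ‖(if u ≤ Real.exp w then Complex.exp (-s * w) else 0)‖) =ᵐ[μ]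
        fun u => ‖(u : ℂ) ^ (-s)‖ / s.re := by
      filter_upwards [hae] with u hu using (stj_inner hs hu).2.2
    simp only [Function.uncurry]
    rw [integrable_congr e]
    constructor
    · rintro ⟨-, h2⟩
      rw [← integrable_norm_iff hcm.aestronglyMeasurable]
      refine (h2.mul_const s.re).congr (Eventually.of_forall fun u => ?_)
      simp only
      field_simp
    · intro h
      refine ⟨?_, h.norm.div_const _⟩
      filter_upwards [hae] with u hu using (stj_inner hs hu).1
  have hfin : ∀ w : ℝ, μ (Iic (Real.exp w)) = ENNReal.ofReal (N (Real.exp w)) := fun w =>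
    stj_measure N hN _
  have hreal : ∀ w : ℝ, μ.real (Iic (Real.exp w)) = N (Real.exp w) := fun w => by
    rw [measureReal_def, hfin, ENNReal.toReal_ofReal (hN0 _)]
  have e1 : ∀ w : ℝ, (fun u : ℝ => if u ≤ Real.exp w then Complex.exp (-s * w) else 0) =
      (Iic (Real.exp w)).indicator (fun _ => Complex.exp (-s * w)) := by
    intro w; ext u; simp [indicator_apply]
  have B : Integrable (Function.uncurry fun (u w : ℝ) =>
      if u ≤ Real.exp w then Complex.exp (-s * w) else 0) (μ.prod volume) ↔
      Integrable (fun w => N (Real.exp w) * Real.exp (-s.re * w)) := by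
    rw [integrable_prod_iff' hmeas.aestronglyMeasurable]
    simp only [Function.uncurry]
    have e : ∀ w : ℝ, ∫ u : ℝ, ‖(if u ≤ Real.exp w then Complex.exp (-s * w) else 0)‖ ∂μ =
        N (Real.exp w) * Real.exp (-s.re * w) := by
      intro w
      have : (fun u : ℝ => ‖(if u ≤ Real.exp w then Complex.exp (-s * w) else 0)‖) =
        (Iic (Real.exp w)).indicator (fun _ => Real.exp (-s.re * w)) := by
        ext u; simp only [indicator_apply, mem_Iic]
        split_ifs
        · rw [Complex.norm_exp]; simp
        · simp
      rw [this, integral_indicator_const _ measurableSet_Iic, hreal, smul_eq_mul]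
    simp_rw [e]
    constructor
    · exact fun h => h.2
    · intro h
      refine ⟨Eventually.of_forall fun w => ?_, h⟩
      rw [e1, integrable_indicator_iff measurableSet_Iic]
      exact integrableOn_const (by rw [hfin]; exact ENNReal.ofReal_ne_top)
  refine ⟨A.symm.trans B, fun h => ?_⟩
  have hp := A.2 h
  have := integral_integral_swap hp
  have e3 : ∫ u, (∫ w : ℝ, (if u ≤ Real.exp w then Complex.exp (-s * w) else 0)) ∂μ =
      ∫ u, (u : ℂ) ^ (-s) / s ∂μ := by
    refine integral_congr_ae ?_
    filter_upwards [hae] with u hu using (stj_inner hs hu).2.1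
  rw [e3, integral_div] at this
  have e4 : ∀ w : ℝ, ∫ u : ℝ, (if u ≤ Real.exp w then Complex.exp (-s * w) else 0) ∂μ =
      (N (Real.exp w) : ℂ) * Complex.exp (-s * w) := by
    intro w
    rw [e1, integral_indicator_const _ measurableSet_Iic, hreal, Complex.real_smul]
  simp_rw [e4] at this
  rw [← this]
  field_simp

lemma stj_tendsto (N : StieltjesFunction ℝ) {s : ℂ}
    (hi : IntegrableOn (fun u : ℝ => (u : ℂ) ^ (-s)) (Ici 1) N.measure) :
    Tendsto (fun X : ℝ => ∫ x in Set.Icc (1:ℝ) X, (x : ℂ) ^ (-s) ∂N.measure) atTop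
      (𝓝 (∫ x in Set.Ici (1:ℝ), (x : ℂ) ^ (-s) ∂N.measure)) := by
  have := (aecover_Iic (μ := N.measure.restrict (Ici 1)) (tendsto_id (α := ℝ) (x := atTop))).integral_tendsto_of_countably_generated hi
  refine this.congr fun X => ?_
  rw [Measure.restrict_restrict measurableSet_Iic, inter_comm, Ici_inter_Iic]; rfl

lemma stj_integrable (N : StieltjesFunction ℝ) {s : ℂ} {l : ℂ}
    (ht : Tendsto (fun X : ℝ => ∫ x in Set.Icc (1:ℝ) X, (x : ℂ) ^ (-(s.re : ℂ)) ∂N.measure) atTop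
      (𝓝 l)) :
    IntegrableOn (fun u : ℝ => (u : ℂ) ^ (-s)) (Ici 1) N.measure := by
  have hcm : Measurable fun u : ℝ => (u : ℂ) ^ (-s) := by fun_prop
  have hae : ∀ᵐ u ∂(N.measure.restrict (Ici 1)), 1 ≤ u := ae_restrict_mem measurableSet_Ici
  suffices h : IntegrableOn (fun u : ℝ => u ^ (-s.re)) (Ici 1) N.measure by
    refine Integrable.mono' h hcm.aestronglyMeasurable ?_
    filter_upwards [hae] with u hu
    rw [Complex.norm_cpow_eq_rpow_re_of_pos (by linarith)]; simp
  have hr : ∀ X : ℝ, (N.measure.restrict (Ici 1)).restrict (Iic (id X)) = N.measure.restrict (Icc 1 X) := by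
    intro X
    rw [Measure.restrict_restrict measurableSet_Iic, inter_comm, Ici_inter_Iic]; rfl
  refine (aecover_Iic (μ := N.measure.restrict (Ici 1)) (tendsto_id (α := ℝ) (x := atTop))).integrable_of_integral_tendsto_of_nonneg_ae l.re ?_ ?_ ?_
  · intro X
    rw [IntegrableOn, hr]
    refine ContinuousOn.integrableOn_Icc ?_
    intro u hu
    exact (Real.continuousAt_rpow_const _ _ (Or.inl (by linarith [hu.1]))).continuousWithinAt
  · filter_upwards [hae] with u hu
    exact Real.rpow_nonneg (by linarith) _
  · simp_rw [hr]
    refine ((Complex.continuous_re.tendsto _).comp ht).congr fun X => ?_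
    simp only [Function.comp]
    have : ∫ x in Set.Icc (1:ℝ) X, (x : ℂ) ^ (-(s.re : ℂ)) ∂N.measure =
        ∫ x in Set.Icc (1:ℝ) X, ((x ^ (-s.re) : ℝ) : ℂ) ∂N.measure := by
      refine setIntegral_congr_fun measurableSet_Icc fun u hu => ?_
      rw [Complex.ofReal_cpow (by linarith [hu.1])]; simp
    rw [this, integral_complex_ofReal, Complex.ofReal_re]

lemma tendsto_iff_h (S : ℝ → ℝ) (hS : Monotone S) (hS0 : ∀ x : ℝ, x < 1 → S x = 0) (a : ℝ) :
    Tendsto (fun x : ℝ => S x / x) atTop (𝓝 a) ↔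
      Tendsto (fun w => hS.stieltjesFunction (Real.exp w) * Real.exp (-w)) atTop (𝓝 a) := by
  have hN : ∀ x, hS.stieltjesFunction x = Function.rightLim S x := fun x => rfl
  have h1 : ∀ x, S x ≤ hS.stieltjesFunction x := fun x => by rw [hN]; exact hS.le_rightLim le_rfl
  have h2 : ∀ x, hS.stieltjesFunction x ≤ S (x + 1) := fun x => by
    rw [hN]; exact hS.rightLim_le (by linarith)
  have hS0' : ∀ x, 0 ≤ S x := fun x => by
    have h1 : S (min x 0) = 0 := hS0 _ (lt_of_le_of_lt (min_le_right _ _) one_pos)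
    rw [← h1]; exact hS (min_le_left _ _)
  have e : Tendsto (fun w => hS.stieltjesFunction (Real.exp w) * Real.exp (-w)) atTop (𝓝 a) ↔
      Tendsto (fun x => hS.stieltjesFunction x / x) atTop (𝓝 a) := by
    constructor
    · intro h
      refine (h.comp Real.tendsto_log_atTop).congr' ?_
      filter_upwards [eventually_gt_atTop 0] with x hx
      simp only [Function.comp, Real.exp_neg, Real.exp_log hx]; rfl
    · intro h
      refine (h.comp Real.tendsto_exp_atTop).congr fun x => ?_
      simp only [Function.comp, Real.exp_neg]; rfl
  have r1 : Tendsto (fun x : ℝ => (x + 1) / x) atTop (𝓝 1) := by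
    have : Tendsto (fun x : ℝ => 1 + x⁻¹) atTop (𝓝 (1 + 0)) := tendsto_inv_atTop_zero.const_add 1
    rw [add_zero] at this
    refine this.congr' ?_
    filter_upwards [eventually_gt_atTop 0] with x hx
    field_simp
  have r2 : Tendsto (fun x : ℝ => (x - 1) / x) atTop (𝓝 1) := by
    have : Tendsto (fun x : ℝ => 1 - x⁻¹) atTop (𝓝 (1 - 0)) := tendsto_inv_atTop_zero.const_sub 1
    rw [sub_zero] at this
    refine this.congr' ?_
    filter_upwards [eventually_gt_atTop 0] with x hx
    field_simp
  rw [e]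
  constructor
  · intro h
    have hu := (h.comp (tendsto_atTop_add_const_right atTop (1 : ℝ) tendsto_id)).mul r1
    rw [mul_one] at hu
    refine tendsto_of_tendsto_of_tendsto_of_le_of_le' h hu ?_ ?_
    · filter_upwards [eventually_gt_atTop 0] with x hx
      exact div_le_div_of_nonneg_right (h1 x) hx.le
    · filter_upwards [eventually_gt_atTop 0] with x hx
      have : S (x + 1) / (x + 1) * ((x + 1) / x) = S (x + 1) / x := by field_simp
      simp only [Function.comp, id]
      rw [this]
      exact div_le_div_of_nonneg_right (h2 x) hx.le
  · intro h
    have hu := (h.comp (tendsto_atTop_add_const_right atTop (-1 : ℝ) tendsto_id)).mul r2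
    rw [mul_one] at hu
    refine tendsto_of_tendsto_of_tendsto_of_le_of_le' hu h ?_ ?_
    · filter_upwards [eventually_gt_atTop 1] with x hx
      have hx1 : x - 1 ≠ 0 := by linarith
      have hx0 : x ≠ 0 := by linarith
      simp only [Function.comp, id]
      rw [← sub_eq_add_neg]
      have : hS.stieltjesFunction (x - 1) / (x - 1) * ((x - 1) / x) =
        hS.stieltjesFunction (x - 1) / x := by field_simp
      rw [this]
      have := h2 (x - 1)
      rw [sub_add_cancel] at this
      exact div_le_div_of_nonneg_right this (by linarith)
    · filter_upwards [eventually_gt_atTop 0] with x hx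
      exact div_le_div_of_nonneg_right (h1 x) hx.le

/-- Distributional Wiener–Ikehara theorem. -/
theorem stmt_10 (S : ℝ → ℝ) (hS : Monotone S) (hS0 : ∀ x : ℝ, x < 1 → S x = 0)
    (a : ℝ) (ha : 0 ≤ a) :
    Tendsto (fun x : ℝ => S x / x) atTop (𝓝 a) ↔
      ∃ F : ℂ → ℂ,
        (∀ s : ℂ, 1 < s.re →
          Tendsto (fun X : ℝ => ∫ x in Set.Icc (1:ℝ) X, (x : ℂ) ^ (-s)
            ∂hS.stieltjesFunction.measure) atTop (𝓝 (F s))) ∧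
        LocalPseudofunctionBoundary (fun s => F s - a / (s - 1)) Set.univ := by
  rw [tendsto_iff_h S hS hS0]
  have hNz : ∀ x < 1, hS.stieltjesFunction x = 0 := by
    intro x hx
    obtain ⟨y, hy1, hy2⟩ := exists_between hx
    refine le_antisymm ?_ ?_
    · rw [← hS0 y hy2]; exact hS.rightLim_le hy1
    · rw [← hS0 x hx]; exact hS.le_rightLim le_rfl
  generalize hS.stieltjesFunction = N at hNz ⊢
  have hN0 : ∀ x, 0 ≤ N x := by
    intro x
    have h1 : N (min x 0) = 0 := hNz _ (lt_of_le_of_lt (min_le_right _ _) one_pos)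
    rw [← h1]; exact N.mono (min_le_left _ _)
  set h : ℝ → ℝ := fun w => N (Real.exp w) * Real.exp (-w) with hh
  have h0 : ∀ w, 0 ≤ h w := fun w => mul_nonneg (hN0 _) (Real.exp_pos _).le
  have hneg : ∀ w < 0, h w = 0 := fun w hw => by
    simp only [hh]; rw [hNz _ (Real.exp_lt_one_iff.2 hw), zero_mul]
  have hm : Monotone fun w => Real.exp w * h w := by
    have : (fun w => Real.exp w * h w) = fun w => N (Real.exp w) := by
      ext w; simp only [hh]
      rw [mul_left_comm, ← Real.exp_add]; simp
    rw [this]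
    exact N.mono.comp Real.exp_monotone
  have e1 : ∀ σ : ℝ, (fun w => N (Real.exp w) * Real.exp (-σ * w)) =
      fun w => h w * Real.exp (-(σ - 1) * w) := by
    intro σ; ext w
    simp only [hh]
    rw [mul_assoc, ← Real.exp_add]; congr 2; ring
  have e2 : ∀ (s : ℂ) (w : ℝ), (N (Real.exp w) : ℂ) * Complex.exp (-s * w) =
      (h w : ℂ) * Complex.exp (-(s - 1) * w) := by
    intro s w
    simp only [hh]
    push_cast
    rw [mul_assoc, ← Complex.exp_add]; congr 2; ring
  constructor
  · intro hlim
    obtain ⟨B, hB⟩ : ∃ B, ∀ y, h y ≤ B := by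
      obtain ⟨y0, hy0⟩ := eventually_atTop.1 (hlim.eventually (eventually_le_nhds (lt_add_one a)))
      exact h_bounded h0 hneg hm hy0
    have hmeas := h_measurable hm
    have hi : ∀ σ > 1, Integrable (fun w => h w * Real.exp (-(σ - 1) * w)) := by
      intro σ hσ
      refine ((hvs_exp_integrable (sub_pos.2 hσ)).const_mul B).mono' (by fun_prop)
        (Eventually.of_forall fun w => ?_)
      rw [norm_mul, Real.norm_eq_abs, Real.norm_eq_abs, abs_of_nonneg (h0 w),
        abs_of_pos (Real.exp_pos _), ← mul_assoc]
      refine mul_le_mul_of_nonneg_right ?_ (Real.exp_pos _).le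
      rcases lt_or_ge w 0 with hw | hw
      · simp [hvs, hneg w hw, not_le.2 hw]
      · simp only [hvs, hw, if_true, mul_one]; exact hB w
    have hI : ∀ s : ℂ, 1 < s.re → IntegrableOn (fun u : ℝ => (u : ℂ) ^ (-s)) (Ici 1) N.measure := by
      intro s hs
      rw [(stj N hNz hs).1, e1]; exact hi _ hs
    refine ⟨fun s => ∫ x in Set.Ici (1:ℝ), (x : ℂ) ^ (-s) ∂N.measure,
      fun s hs => stj_tendsto N (hI s hs), ?_⟩
    refine fwd h0 hneg hm ha hi (fun s hs => ?_) hlim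
    rw [(stj N hNz hs).2 (hI s hs)]
    simp_rw [e2]
  · rintro ⟨F, hF, hlpb⟩
    have hI : ∀ s : ℂ, 1 < s.re → IntegrableOn (fun u : ℝ => (u : ℂ) ^ (-s)) (Ici 1) N.measure :=
      fun s hs => stj_integrable N (hF (s.re : ℂ) (by simpa using hs))
    refine bwd h0 hneg hm ha (fun σ hσ => ?_) (fun s hs => ?_) hlpb
    · have hs : 1 < (σ : ℂ).re := by simpa using hσ
      have := (stj N hNz hs).1.1 (hI _ hs)
      rw [e1] at this
      simpa using this
    · rw [tendsto_nhds_unique (hF s hs) (stj_tendsto N (hI s hs)), (stj N hNz hs).2 (hI s hs)]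
      simp_rw [e2]
end

section
/- (Extension of the Ingham–Fatou–Riesz theorem.) Let τ be a real-valued, locally integrable function on [1, ∞) that is slowly decreasing, and let a, b ∈ ℝ. Then τ(x) = a log x + b + o(1) as x → ∞ if and only if the Mellin transform F(s) = ∫_1^∞ x^{−s} τ(x) dx converges, as an improper integral lim_{X→∞} ∫_1^X x^{−s} τ(x) dx, for every s with Re s > 1, and the function s ↦ F(s) − a/(s − 1)² − b/(s − 1) has local pseudofunction boundary behavior on the line 1 + iℝ. -/
open Filter MeasureTheory Set Topology
open scoped Classical

/-- `τ` is slowly decreasing (with multiplicative arguments): for each `ε > 0` there is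
`c > 1` with `liminf_{x→∞} inf_{η ∈ [1,c]} (τ(ηx) - τ(x)) ≥ -ε`. -/
def SlowlyDecreasing (τ : ℝ → ℝ) : Prop :=
  ∀ ε : ℝ, 0 < ε → ∃ c : ℝ, 1 < c ∧ ∀ ε' : ℝ, ε < ε' →
    ∀ᶠ x : ℝ in atTop, ∀ η ∈ Set.Icc (1:ℝ) c, τ (η * x) - τ x ≥ -ε'

noncomputable def ft (φ : ℝ → ℂ) (y : ℝ) : ℂ := ∫ t : ℝ, φ t * Complex.exp (-(y * t) * Complex.I)

open FourierTransform in
lemma ft_eq_fourier (φ : ℝ → ℂ) (y : ℝ) : ft φ y = 𝓕 φ (y / (2 * Real.pi)) := by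
  rw [Real.fourier_real_eq_integral_exp_smul, ft]
  congr 1
  ext t
  rw [smul_eq_mul, mul_comm]
  congr 2
  push_cast
  have : (Real.pi : ℂ) ≠ 0 := by exact_mod_cast Real.pi_ne_zero
  field_simp

lemma ft_facts (φ : ℝ → ℂ) (h1 : ContDiff ℝ (⊤ : ℕ∞) φ) (h2 : HasCompactSupport φ) :
    Continuous (ft φ) ∧ ∃ C, 0 ≤ C ∧ ∀ y, (1 + |y|) ^ 3 * ‖ft φ y‖ ≤ C := by
  obtain ⟨k, hk⟩ : ∃ k : SchwartzMap ℝ ℂ, ∀ y, ft φ y = k (y / (2 * Real.pi)) := by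
    refine ⟨FourierTransform.fourier (h2.toSchwartzMap h1), fun y => ?_⟩
    rw [ft_eq_fourier, SchwartzMap.fourier_coe]
    rfl
  have hpi : (1:ℝ) ≤ 2 * Real.pi := by linarith [Real.pi_gt_three]
  constructor
  · rw [show ft φ = fun y => k (y / (2 * Real.pi)) from funext hk]
    exact k.continuous.comp (by fun_prop)
  · have := fun x => k.one_add_le_sup_seminorm_apply (𝕜 := ℝ) (m := (3, 0)) (k := 3) (n := 0) le_rfl le_rfl x
    set C := 2 ^ 3 * ((Finset.Iic (3, 0)).sup fun m => SchwartzMap.seminorm ℝ m.1 m.2) k with hC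
    refine ⟨(2 * Real.pi) ^ 3 * C, ?_, fun y => ?_⟩
    · have := (le_trans (by positivity) (this 0)); positivity
    · have h := this (y / (2 * Real.pi))
      rw [norm_iteratedFDeriv_zero] at h
      rw [hk]
      have h3 : 1 + |y| ≤ (2 * Real.pi) * (1 + ‖y / (2 * Real.pi)‖) := by
        rw [Real.norm_eq_abs, abs_div, abs_of_pos (show 0 < 2 * Real.pi by positivity)]
        have : (2 * Real.pi) * (1 + |y| / (2 * Real.pi)) = 2 * Real.pi + |y| := by
          field_simp
        rw [this]; linarith
      calc _ ≤ ((2 * Real.pi) * (1 + ‖y / (2 * Real.pi)‖)) ^ 3 * ‖k (y / (2 * Real.pi))‖ := by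
            gcongr
        _ = (2 * Real.pi) ^ 3 * ((1 + ‖y / (2 * Real.pi)‖) ^ 3 * ‖k (y / (2 * Real.pi))‖) := by ring
        _ ≤ _ := by gcongr

lemma integrable_weight : Integrable (fun x : ℝ => ((1 + |x|) ^ 2)⁻¹) := by
  have := integrable_one_add_norm (E := ℝ) (μ := volume) (r := 2) (by simp)
  refine this.congr (Eventually.of_forall fun x => ?_)
  simp only [Real.norm_eq_abs]
  rw [Real.rpow_neg (by positivity)]
  norm_cast

/-- decay gives weighted integrability -/
lemma decay_le {k : ℝ → ℂ} {C : ℝ} (h : ∀ y, (1 + |y|) ^ 3 * ‖k y‖ ≤ C) (y : ℝ) :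
    (1 + |y|) * ‖k y‖ ≤ C * ((1 + |y|) ^ 2)⁻¹ := by
  rw [← div_eq_mul_inv, le_div_iff₀ (by positivity)]
  calc _ = (1 + |y|) ^ 3 * ‖k y‖ := by ring
    _ ≤ C := h y

lemma decay_integrable {k : ℝ → ℂ} {C : ℝ} (hc : Continuous k)
    (h : ∀ y, (1 + |y|) ^ 3 * ‖k y‖ ≤ C) :
    Integrable (fun y => (1 + |y|) * ‖k y‖) := by
  refine (integrable_weight.const_mul C).mono' (by fun_prop) (Eventually.of_forall fun y => ?_)
  rw [Real.norm_of_nonneg (by positivity)]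
  exact decay_le h y

lemma decay_integrable' {k : ℝ → ℂ} {C : ℝ} (hc : Continuous k)
    (h : ∀ y, (1 + |y|) ^ 3 * ‖k y‖ ≤ C) :
    Integrable k := by
  refine (decay_integrable hc h).mono' (by fun_prop) (Eventually.of_forall fun y => ?_)
  have : 0 ≤ |y| * ‖k y‖ := by positivity
  linarith

lemma decay_bdd {k : ℝ → ℂ} {C : ℝ} 
    (h : ∀ y, (1 + |y|) ^ 3 * ‖k y‖ ≤ C) (y : ℝ) : ‖k y‖ ≤ C := by
  refine le_trans ?_ (h y)
  have : (1:ℝ) ≤ (1 + |y|) ^ 3 := one_le_pow₀ (by linarith [abs_nonneg y])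
  nlinarith [norm_nonneg (k y)]

lemma decay_tendsto {k : ℝ → ℂ} {C : ℝ} 
    (h : ∀ y, (1 + |y|) ^ 3 * ‖k y‖ ≤ C) : Tendsto k (cocompact ℝ) (𝓝 0) := by
  rw [tendsto_zero_iff_norm_tendsto_zero]
  have h1 : Tendsto (fun y : ℝ => C * (‖y‖)⁻¹) (cocompact ℝ) (𝓝 0) := by
    have := (tendsto_inv_atTop_zero.comp (tendsto_norm_cocompact_atTop (E := ℝ))).const_mul C
    simpa using this
  refine squeeze_zero' (Eventually.of_forall fun y => norm_nonneg _) ?_ h1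
  have : ∀ᶠ y in cocompact ℝ, (1:ℝ) ≤ ‖y‖ := (tendsto_norm_cocompact_atTop (E := ℝ)).eventually_ge_atTop 1
  filter_upwards [this] with y hy
  rw [← div_eq_mul_inv, le_div_iff₀ (by positivity)]
  refine le_trans ?_ (h y)
  rw [Real.norm_eq_abs] at *
  have : |y| ≤ (1 + |y|) ^ 3 := by nlinarith [abs_nonneg y, mul_nonneg (abs_nonneg y) (abs_nonneg y), mul_nonneg (mul_nonneg (abs_nonneg y) (abs_nonneg y)) (abs_nonneg y)]
  nlinarith [norm_nonneg (k y)]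

open Convolution in
lemma base_kernel : ∃ φ : ℝ → ℂ, ContDiff ℝ (⊤ : ℕ∞) φ ∧ HasCompactSupport φ ∧ ∃ K : ℝ → ℝ,
    (∀ y, ft φ y = K y) ∧ (∀ y, 0 ≤ K y) ∧ 0 < ∫ y, K y := by
  let B : ContDiffBump (0:ℝ) := ⟨1, 2, one_pos, by norm_num⟩
  let ψ : ℝ → ℂ := fun t => (B t : ℂ)
  have hψ1 : ContDiff ℝ (⊤ : ℕ∞) ψ := Complex.ofRealCLM.contDiff.comp B.contDiff
  have hψ2 : HasCompactSupport ψ := B.hasCompactSupport.comp_left (g := fun x : ℝ => (x:ℂ)) (by simp)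
  have hψi : Integrable ψ := hψ1.continuous.integrable_of_hasCompactSupport hψ2
  let φ : ℝ → ℂ := ψ ⋆[ContinuousLinearMap.mul ℂ ℂ] ψ
  have hφ1 : ContDiff ℝ (⊤ : ℕ∞) φ := by
    have h := hψ2.contDiff_convolution_left (ContinuousLinearMap.mul ℝ ℂ) hψ1
      hψi.locallyIntegrable (𝕜 := ℝ) (n := ⊤) (μ := volume)
    exact h
  have hφ2 : HasCompactSupport φ := hψ2.convolution _ hψ2
  have hreal : ∀ y, ft ψ y = ((ft ψ y).re : ℂ) := by
    intro y
    rw [eq_comm, ← Complex.conj_eq_iff_re]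
    rw [ft, ← integral_conj, ← integral_neg_eq_self]
    congr 1
    ext t
    simp only [map_mul, ψ, ← Complex.exp_conj, B.neg, Complex.conj_ofReal, map_neg, Complex.conj_I]
    congr 2
    push_cast
    ring
  have hK : ∀ y, ft φ y = (((ft ψ y).re ^ 2 : ℝ) : ℂ) := by
    intro y
    rw [ft_eq_fourier, Real.fourier_mul_convolution_eq hψi hψi, ← ft_eq_fourier, hreal y]
    push_cast
    simp
    ring
  refine ⟨φ, hφ1, hφ2, fun y => (ft ψ y).re ^ 2, hK, fun y => by positivity, ?_⟩
  obtain ⟨hc, C, -, hC⟩ := ft_facts φ hφ1 hφ2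
  have hi := (decay_integrable' hc hC).re
  have hi : Integrable (fun y => (ft ψ y).re ^ 2) := by
    refine hi.congr (Eventually.of_forall fun y => ?_)
    simp only [hK, RCLike.re_to_complex, Complex.ofReal_re]
  rw [integral_pos_iff_support_of_nonneg (fun y => by positivity) hi]
  have hc2 := (ft_facts ψ hψ1 hψ2).1
  apply IsOpen.measure_pos
  · exact Continuous.isOpen_support (by fun_prop)
  · refine ⟨0, ?_⟩
    rw [Function.mem_support]
    have : ft ψ 0 = ((∫ t, B t : ℝ) : ℂ) := by
      simp [ft, ψ, integral_complex_ofReal]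
    rw [this, Complex.ofReal_re]
    have := B.integral_pos (μ := volume)
    positivity

lemma kernel_exists (δ ε : ℝ) (hδ : 0 < δ) (hε : 0 < ε) :
    ∃ φ : ℝ → ℂ, ContDiff ℝ (⊤ : ℕ∞) φ ∧ HasCompactSupport φ ∧ ∃ K : ℝ → ℝ,
    (∀ y, ft φ y = K y) ∧ (∀ y, 0 ≤ K y) ∧ ∫ y, K y = 1 ∧
    ∫ y in {y | δ < |y|}, (1 + |y|) * K y ≤ ε := by
  obtain ⟨φ, h1, h2, K, hK, hK0, hKi⟩ := base_kernel
  obtain ⟨hc, C, -, hC⟩ := ft_facts φ h1 h2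
  have hKn : ∀ y, ‖ft φ y‖ = K y := fun y => by
    rw [hK, Complex.norm_real, Real.norm_of_nonneg (hK0 y)]
  have hw := decay_integrable hc hC
  simp only [hKn] at hw
  have hKc : Continuous K := by
    have : K = fun y => ‖ft φ y‖ := by ext; rw [hKn]
    rw [this]; fun_prop
  set c := (∫ y, K y)⁻¹ with hcdef
  have hcpos : 0 < c := by positivity
  have hlim : Tendsto (fun n : ℕ => ∫ v, ({v : ℝ | (n + 1) * δ < |v|}.indicator (fun v => (1 + |v|) * K v)) v)
      atTop (𝓝 0) := by
    have : (0:ℝ) = ∫ v : ℝ, (0:ℝ) := by simp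
    rw [this]
    refine tendsto_integral_of_dominated_convergence (fun v => (1 + |v|) * K v) ?_ hw ?_ ?_
    · intro n
      exact (hw.aestronglyMeasurable).indicator (measurableSet_lt (by fun_prop) (by fun_prop))
    · intro n
      filter_upwards with v
      refine (norm_indicator_le_norm_self _ _).trans ?_
      rw [Real.norm_of_nonneg (mul_nonneg (by positivity) (hK0 v))]
    · filter_upwards with v
      apply tendsto_const_nhds.congr'
      obtain ⟨N, hN⟩ := exists_nat_gt (|v| / δ)
      filter_upwards [eventually_ge_atTop N] with n hn
      rw [indicator_of_notMem]
      simp only [mem_ofPred_eq, not_lt]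
      rw [div_lt_iff₀ hδ] at hN
      have : (N:ℝ) ≤ n := by exact_mod_cast hn
      nlinarith
  obtain ⟨n, hn⟩ := (hlim.eventually (gt_mem_nhds (show 0 < ε / c by positivity))).exists
  set l : ℝ := n + 1 with hl
  have hl1 : 1 ≤ l := by rw [hl]; linarith [Nat.cast_nonneg (α := ℝ) n]
  have hl0 : 0 < l := by linarith
  refine ⟨fun t => c * φ (t / l), ?_, ?_, fun y => c * l * K (l * y), ?_, ?_, ?_, ?_⟩
  · exact contDiff_const.mul (h1.comp (contDiff_id.div_const _))
  · have : HasCompactSupport (fun t => φ (t / l)) := by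
      have := h2.comp_homeomorph (Homeomorph.mulRight₀ l⁻¹ (by positivity))
      simpa [div_eq_mul_inv, Function.comp_def] using this
    exact this.mul_left
  · intro y
    have := Measure.integral_comp_div (fun t : ℝ => c * (φ t * Complex.exp (-((l * y) * t) * Complex.I))) l
    simp only [ft]
    rw [show (∫ t, c * φ (t / l) * Complex.exp (-(y * t) * Complex.I)) = ∫ t : ℝ, (fun t : ℝ => c * (φ t * Complex.exp (-((l * y) * t) * Complex.I))) (t / l) from ?_, this]
    · rw [integral_const_mul]
      have h := hK (l * y)
      simp only [ft] at h
      push_cast at h ⊢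
      rw [h, abs_of_pos hl0]
      simp; ring
    · congr 1
      ext t
      have : (l:ℂ) ≠ 0 := by exact_mod_cast hl0.ne'
      simp only []
      rw [← mul_assoc]
      congr 3
      push_cast
      field_simp
  · intro y
    exact mul_nonneg (by positivity) (hK0 _)
  · rw [integral_const_mul, Measure.integral_comp_mul_left K l, abs_of_pos (by positivity), smul_eq_mul]
    rw [hcdef]; field_simp
  · have hm : ∀ m : ℝ, MeasurableSet {v : ℝ | m < |v|} := fun m =>
      measurableSet_lt (by fun_prop) (by fun_prop)
    rw [← integral_indicator (hm _)]
    have h4 := Measure.integral_comp_mul_left ({v : ℝ | l * δ < |v|}.indicator (fun v => (1 + |v|) * K v)) l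
    have hint : Integrable ({v : ℝ | l * δ < |v|}.indicator (fun v => (1 + |v|) * K v)) :=
      hw.indicator (hm _)
    calc _ ≤ ∫ y, c * l * ({v : ℝ | l * δ < |v|}.indicator (fun v => (1 + |v|) * K v)) (l * y) := by
          refine integral_mono_of_nonneg ?_ ((hint.comp_mul_left' hl0.ne').const_mul _) ?_
          · filter_upwards with y
            exact indicator_nonneg (fun y _ => mul_nonneg (by positivity) (mul_nonneg (by positivity) (hK0 _))) _
          · filter_upwards with y
            by_cases hy : δ < |y|
            · rw [indicator_of_mem (show y ∈ {y | δ < |y|} from hy), indicator_of_mem]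
              · have : 1 + |y| ≤ 1 + |l * y| := by
                  rw [abs_mul, abs_of_pos hl0]; nlinarith [abs_nonneg y]
                have h5 : 0 ≤ c * l * K (l * y) := mul_nonneg (by positivity) (hK0 _)
                nlinarith
              · simp only [mem_ofPred_eq]; rw [abs_mul, abs_of_pos hl0]; nlinarith
            · rw [indicator_of_notMem (show y ∉ {y | δ < |y|} from hy)]
              exact mul_nonneg (by positivity) (indicator_nonneg (fun y _ => mul_nonneg (by positivity) (hK0 _)) _)
      _ = c * ∫ v, ({v : ℝ | l * δ < |v|}.indicator (fun v => (1 + |v|) * K v)) v := by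
          rw [integral_const_mul, h4, abs_of_pos (by positivity), smul_eq_mul]
          field_simp
      _ ≤ c * (ε / c) := by gcongr
      _ = ε := by field_simp

lemma taub_ptwise {f K : ℝ → ℝ} {y δ ε N m : ℝ} (hK0 : ∀ x, 0 ≤ K x) (hKm : Continuous K)
    (hKw : Integrable fun x => (1 + |x|) * K x) (hK1 : ∫ x, K x = 1)
    (htail : ∫ x in {x | δ < |x|}, (1 + |x|) * K x ≤ ε) (hε : ε ≤ 1 / 2) (hε0 : 0 ≤ ε) (hN : 0 ≤ N)
    (hint : Integrable fun u => f u * K (u - y)) (hle : ∫ u, f u * K (u - y) ≤ ε)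
    (hm : ∀ u, |u - y| ≤ δ → m ≤ f u) (hlow : ∀ u, -(N * (1 + |u - y|)) ≤ f u) :
    m ≤ 2 * (ε * (1 + N)) := by
  by_cases hm0 : m < 0
  · have : 0 ≤ 2 * (ε * (1 + N)) := by positivity
    linarith
  push Not at hm0
  set A : Set ℝ := {x | δ < |x|} with hA
  have hAm : MeasurableSet A := measurableSet_lt (by fun_prop) (by fun_prop)
  have hKi : Integrable K := by
    refine hKw.mono' hKm.aestronglyMeasurable (Eventually.of_forall fun x => ?_)
    rw [Real.norm_of_nonneg (hK0 x)]
    nlinarith [abs_nonneg x, hK0 x, mul_nonneg (abs_nonneg x) (hK0 x)]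
  have htail2 : ∫ x in A, K x ≤ ε := by
    refine le_trans (integral_mono hKi.integrableOn hKw.integrableOn fun x => ?_) htail
    simp only []
    nlinarith [abs_nonneg x, hK0 x, mul_nonneg (abs_nonneg x) (hK0 x)]
  have h1 : ∫ x, f (x + y) * K x = ∫ u, f u * K (u - y) := by
    rw [← integral_add_right_eq_self (fun u => f u * K (u - y)) y]
    simp
  have hint1 : Integrable fun x => f (x + y) * K x := by
    have := hint.comp_add_right y
    simpa using this
  have hsplit := integral_add_compl hAm hint1
  have hsplitK := integral_add_compl hAm hKi
  have e1 : -(N * ε) ≤ ∫ x in A, f (x + y) * K x := by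
    have : ∫ x in A, -(N * ((1 + |x|) * K x)) ≤ ∫ x in A, f (x + y) * K x := by
      refine integral_mono (hKw.const_mul N).neg.integrableOn hint1.integrableOn fun x => ?_
      have := hlow (x + y)
      simp only [add_sub_cancel_right] at this
      have h := mul_le_mul_of_nonneg_right this (hK0 x)
      simp only []
      linarith
    rw [integral_neg, integral_const_mul] at this
    nlinarith
  have e2 : m * ∫ x in Aᶜ, K x ≤ ∫ x in Aᶜ, f (x + y) * K x := by
    rw [← integral_const_mul]
    refine setIntegral_mono_on (hKi.const_mul m).integrableOn hint1.integrableOn hAm.compl ?_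
    intro x hx
    have hx' : |x| ≤ δ := not_lt.1 hx
    exact mul_le_mul_of_nonneg_right (hm _ (by simpa using hx')) (hK0 x)
  have e3 : 1 / 2 ≤ ∫ x in Aᶜ, K x := by linarith
  nlinarith

lemma taub_step {f : ℝ → ℝ}
    (hker : ∀ δ ε : ℝ, 0 < δ → 0 < ε → ∃ K : ℝ → ℝ, (∀ x, 0 ≤ K x) ∧ Continuous K ∧
      Integrable (fun x => (1 + |x|) * K x) ∧ ∫ x, K x = 1 ∧
      ∫ x in {x | δ < |x|}, (1 + |x|) * K x ≤ ε ∧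
      (∀ y, Integrable fun u => f u * K (u - y)) ∧
      Tendsto (fun y => ∫ u, f u * K (u - y)) atTop (𝓝 0))
    (hsd : ∀ ε : ℝ, 0 < ε → ∃ δ : ℝ, 0 < δ ∧ ∃ V : ℝ, ∀ u ≥ V, ∀ h, 0 ≤ h → h ≤ δ → f u - ε ≤ f (u + h))
    (ω ε : ℝ) (hω : 0 < ω) (hε : 0 < ε) (hε' : ε ≤ 1 / 2) :
    ∃ H : ℝ, ∀ h ≥ H, ∀ N : ℝ, 0 ≤ N →
      ((∀ u, -(N * (1 + |u - h|)) ≤ f u) → f h ≤ ω + ε * (1 + N)) ∧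
      ((∀ u, f u ≤ N * (1 + |u - h|)) → -f h ≤ ω + ε * (1 + N)) := by
  obtain ⟨δ, hδ, V, hV⟩ := hsd ω hω
  set d := min (δ / 2) 1 with hd
  have hd0 : 0 < d := by positivity
  have hd1 : d ≤ 1 := min_le_right _ _
  have hd2 : 2 * d ≤ δ := by have := min_le_left (δ / 2) 1; linarith
  obtain ⟨K, hK0, hKc, hKw, hK1, htail, hint, hlim⟩ := hker d (ε / 4) hd0 (by positivity)
  have hlim' := hlim.eventually (Metric.ball_mem_nhds 0 (show 0 < ε / 4 by positivity))
  obtain ⟨Y, hY⟩ := eventually_atTop.1 hlim'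
  have hw : ∀ u h y : ℝ, |y - h| ≤ d → 1 + |u - h| ≤ 2 * (1 + |u - y|) := by
    intro u h y hy
    have : |u - h| ≤ |u - y| + |y - h| := abs_sub_le _ _ _
    linarith [abs_nonneg (u - y)]
  refine ⟨max V Y + 2 * d, fun h hh N hN => ⟨fun hf => ?_, fun hf => ?_⟩⟩
  · have hVh : V ≤ h := by linarith [le_max_left V Y]
    have hYh : Y ≤ h + d := by linarith [le_max_right V Y]
    have hb := hY _ hYh
    rw [dist_zero_right, Real.norm_eq_abs, abs_lt] at hb
    have := taub_ptwise (f := f) (y := h + d) (N := 2 * N) (m := f h - ω) hK0 hKc hKw hK1 htail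
      (by linarith) (by positivity) (by positivity) (hint _) hb.2.le ?_ ?_
    · nlinarith
    · intro u hu
      rw [abs_le] at hu
      have := hV h hVh (u - h) (by linarith) (by linarith)
      simpa using this
    · intro u
      refine le_trans ?_ (hf u)
      have := mul_le_mul_of_nonneg_left (hw u h (h + d) (by simp [abs_of_pos hd0])) hN
      linarith
  · have hYh : Y ≤ h - d := by linarith [le_max_right V Y]
    have hb := hY _ hYh
    rw [dist_zero_right, Real.norm_eq_abs, abs_lt] at hb
    have := taub_ptwise (f := fun u => -f u) (y := h - d) (N := 2 * N) (m := -f h - ω) hK0 hKc hKw hK1 htail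
      (by linarith) (by positivity) (by positivity) ?_ ?_ ?_ ?_
    · nlinarith
    · simpa using (hint (h - d)).neg
    · simp only [neg_mul, integral_neg]; linarith
    · intro u hu
      rw [abs_le] at hu
      have := hV u (by linarith [le_max_left V Y]) (h - u) (by linarith) (by linarith)
      rw [add_sub_cancel] at this
      linarith
    · intro u
      have h1 := mul_le_mul_of_nonneg_left (hw u h (h - d) (by simp [abs_of_pos hd0])) hN
      have h2 := hf u
      linarith

lemma taub_main {f : ℝ → ℝ} {U C : ℝ} (hC : 0 ≤ C)
    (hker : ∀ δ ε : ℝ, 0 < δ → 0 < ε → ∃ K : ℝ → ℝ, (∀ x, 0 ≤ K x) ∧ Continuous K ∧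
      Integrable (fun x => (1 + |x|) * K x) ∧ ∫ x, K x = 1 ∧
      ∫ x in {x | δ < |x|}, (1 + |x|) * K x ≤ ε ∧
      (∀ y, Integrable fun u => f u * K (u - y)) ∧
      Tendsto (fun y => ∫ u, f u * K (u - y)) atTop (𝓝 0))
    (hsd : ∀ ε : ℝ, 0 < ε → ∃ δ : ℝ, 0 < δ ∧ ∃ V : ℝ, ∀ u ≥ V, ∀ h, 0 ≤ h → h ≤ δ → f u - ε ≤ f (u + h))
    (hU : 0 ≤ U) (hz : ∀ u < U, f u = 0)
    (hgrow : ∀ u v, U ≤ u → u ≤ v → f u - C * (1 + (v - u)) ≤ f v) :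
    Tendsto f atTop (𝓝 0) := by
  have hstep := taub_step hker hsd
  have hadd : ∀ u h : ℝ, 1 + |u| ≤ (1 + |h|) * (1 + |u - h|) := by
    intro u h
    have : |u| ≤ |h| + |u - h| := by
      have := abs_add_le h (u - h); simpa using this
    nlinarith [abs_nonneg h, abs_nonneg (u - h), mul_nonneg (abs_nonneg h) (abs_nonneg (u - h))]
  -- linear lower bound
  set C1 := |f U| + C with hC1
  have hC10 : 0 ≤ C1 := by positivity
  have hlow : ∀ u, -(C1 * (1 + |u|)) ≤ f u := by
    intro u
    by_cases hu : u < U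
    · rw [hz u hu]
      have : 0 ≤ C1 * (1 + |u|) := by positivity
      linarith
    · push Not at hu
      have h1 := hgrow U u le_rfl hu
      have hu0 : 0 ≤ u := hU.trans hu
      rw [abs_of_nonneg hu0]
      have h2 := neg_abs_le (f U)
      have h3 : 0 ≤ |f U| * u := by positivity
      have h4 : 0 ≤ C * U := by positivity
      rw [hC1]
      nlinarith
  -- linear bound
  obtain ⟨D, hD0, hD⟩ : ∃ D, 0 ≤ D ∧ ∀ u, |f u| ≤ D * (1 + |u|) := by
    obtain ⟨H, hH⟩ := hstep 1 (1 / 2) one_pos (by norm_num) le_rfl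
    have hup : ∀ h ≥ H, f h ≤ 2 + C1 * (1 + |h|) := by
      intro h hh
      have := (hH h hh (C1 * (1 + |h|)) (by positivity)).1 ?_
      · have : 0 ≤ C1 * (1 + |h|) := by positivity
        linarith
      · intro u
        refine le_trans ?_ (hlow u)
        have := mul_le_mul_of_nonneg_left (hadd u h) hC10
        linarith
    set H1 := max H U with hH1
    refine ⟨2 + C1 + |f H1| + C * (1 + H1), by have := hU.trans (le_max_right H U); positivity, fun u => ?_⟩
    have hH10 : 0 ≤ H1 := hU.trans (le_max_right H U)
    have hx : 0 ≤ |u| := abs_nonneg u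
    have g1 : 0 ≤ C1 * (1 + |u|) := by positivity
    have g2 : 0 ≤ |f H1| * |u| := by positivity
    have g3 : 0 ≤ C * (1 + H1) := by positivity
    have g4 : 0 ≤ C * (1 + H1) * |u| := by positivity
    have g5 : 0 ≤ |f H1| := by positivity
    rw [abs_le]
    constructor
    · have := hlow u
      nlinarith
    · by_cases hu : u < U
      · rw [hz u hu]
        nlinarith
      · push Not at hu
        by_cases hu2 : H1 ≤ u
        · have := hup u ((le_max_left _ _).trans hu2)
          nlinarith
        · push Not at hu2
          have h1 := hgrow u H1 hu hu2.le
          have h2 := le_abs_self (f H1)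
          have : C * (1 + (H1 - u)) ≤ C * (1 + H1) := by
            apply mul_le_mul_of_nonneg_left _ hC
            linarith
          nlinarith
  -- boundedness
  obtain ⟨B, hB0, hB⟩ : ∃ B, 0 ≤ B ∧ ∀ u, |f u| ≤ B := by
    obtain ⟨H, hH⟩ := hstep 1 (1 / 8) one_pos (by norm_num) (by norm_num)
    set B := 2 + D * (1 + |H|) with hBdef
    have hB0 : 0 ≤ B := by positivity
    refine ⟨4 * B, by positivity, fun v => ?_⟩
    set η := 1 / (1 + |v|) with hη
    have hη0 : 0 < η := by positivity
    have hη1 : η ≤ 1 := by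
      rw [hη, div_le_one (by positivity)]; linarith [abs_nonneg v]
    have hwpos : ∀ u : ℝ, 0 < 1 + η * |u| := fun u => by positivity
    let q : ℝ → ℝ := fun u => |f u| / (1 + η * |u|)
    have hbdd : BddAbove (range q) := by
      refine ⟨D / η, ?_⟩
      rintro _ ⟨u, rfl⟩
      simp only [q]
      rw [div_le_div_iff₀ (hwpos u) hη0]
      have h1 := hD u
      have h2 : 0 ≤ D * |u| := by positivity
      calc |f u| * η ≤ D * (1 + |u|) * η := by gcongr
        _ = D * (η + η * |u|) := by ring
        _ ≤ _ := by gcongr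
    set W := ⨆ u, q u with hW
    have hqW : ∀ u, q u ≤ W := fun u => le_ciSup hbdd u
    have hWB : W ≤ 2 * B := by
      by_cases hW0 : W ≤ 0
      · linarith
      · push Not at hW0
        obtain ⟨h, hh⟩ := exists_lt_of_lt_ciSup (show W / 2 < ⨆ u, q u by rw [← hW]; linarith)
        have hfh : |f h| ≤ B := by
          by_cases hHh : H ≤ h
          · have key : ∀ u, |f u| ≤ 2 * |f h| * (1 + |u - h|) := by
              intro u
              have h1 := hqW u
              simp only [q] at h1 hh
              rw [div_le_iff₀ (hwpos u)] at h1
              rw [lt_div_iff₀ (hwpos h)] at hh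
              have h2 : 1 + η * |u| ≤ (1 + η * |h|) * (1 + |u - h|) := by
                have : |u| ≤ |h| + |u - h| := by
                  have := abs_add_le h (u - h); simpa using this
                have e1 : η * |u| ≤ η * (|h| + |u - h|) := by gcongr
                have e2 : 0 ≤ η * |h| * |u - h| := by positivity
                have e3 : η * |u - h| ≤ 1 * |u - h| := by gcongr
                nlinarith
              calc |f u| ≤ W * (1 + η * |u|) := h1
                _ ≤ W * ((1 + η * |h|) * (1 + |u - h|)) := by gcongr
                _ = (2 * (W / 2 * (1 + η * |h|))) * (1 + |u - h|) := by ring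
                _ ≤ _ := by gcongr
            obtain ⟨k1, k2⟩ := hH h hHh (2 * |f h|) (by positivity)
            have k1 := k1 fun u => (abs_le.1 (key u)).1
            have k2 := k2 fun u => (abs_le.1 (key u)).2
            have : |f h| ≤ 1 + 1 / 8 * (1 + 2 * |f h|) := abs_le.2 ⟨by linarith, k1⟩
            have : 0 ≤ D * (1 + |H|) := by positivity
            linarith
          · push Not at hHh
            by_cases hu : h < U
            · rw [hz h hu, abs_zero]; exact hB0
            · push Not at hu
              have : |h| ≤ |H| := by
                rw [abs_of_nonneg (hU.trans hu)]
                exact hHh.le.trans (le_abs_self _)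
              calc |f h| ≤ D * (1 + |h|) := hD h
                _ ≤ D * (1 + |H|) := by gcongr
                _ ≤ B := by linarith
        have : q h ≤ |f h| := by
          simp only [q]
          apply div_le_self (abs_nonneg _)
          have : 0 ≤ η * |h| := by positivity
          linarith
        linarith
    have h1 := (hqW v).trans hWB
    simp only [q] at h1
    rw [div_le_iff₀ (hwpos v)] at h1
    have h2 : η * |v| ≤ 1 := by
      rw [hη, one_div, inv_mul_le_iff₀ (by positivity)]; linarith
    nlinarith
  -- conclusion
  rw [Metric.tendsto_atTop]
  intro e he
  set ε := min (1 / 2) (e / (4 * (1 + B))) with hε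
  have hε0 : 0 < ε := by positivity
  have hε1 : ε * (1 + B) ≤ e / 4 := by
    have : ε ≤ e / (4 * (1 + B)) := min_le_right _ _
    calc ε * (1 + B) ≤ e / (4 * (1 + B)) * (1 + B) := by gcongr
      _ = e / 4 := by field_simp
  obtain ⟨H, hH⟩ := hstep (e / 4) ε (by positivity) hε0 (min_le_left _ _)
  refine ⟨H, fun h hh => ?_⟩
  obtain ⟨k1, k2⟩ := hH h hh B hB0
  have hle : ∀ u, B ≤ B * (1 + |u - h|) := fun u => by nlinarith [abs_nonneg (u - h), mul_nonneg hB0 (abs_nonneg (u - h))]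
  have k1 := k1 fun u => by linarith [hle u, (abs_le.1 (hB u)).1]
  have k2 := k2 fun u => by linarith [hle u, (abs_le.1 (hB u)).2]
  rw [Real.dist_eq, sub_zero, abs_lt]
  constructor <;> linarith

instance : IsCountablyGenerated (cocompact ℝ) := by
  rw [cocompact_eq_atBot_atTop]; infer_instance

lemma conv_tendsto_zero {f : ℝ → ℝ} (hf : Integrable f) {k : ℝ → ℂ} {C : ℝ} (hc : Continuous k)
    (h : ∀ y, (1 + |y|) ^ 3 * ‖k y‖ ≤ C) :
    Tendsto (fun x => ∫ u, (f u : ℂ) * k (u + x)) (cocompact ℝ) (𝓝 0) := by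
  have h0 : (0:ℂ) = ∫ u : ℝ, (0:ℂ) := by simp
  rw [h0]
  refine tendsto_integral_filter_of_dominated_convergence (fun u => ‖f u‖ * C) ?_ ?_
    (hf.norm.mul_const C) ?_
  · filter_upwards with x
    exact (Complex.continuous_ofReal.comp_aestronglyMeasurable hf.aestronglyMeasurable).mul
      (hc.comp (continuous_add_const x)).aestronglyMeasurable
  · filter_upwards with x
    filter_upwards with u
    rw [norm_mul, Complex.norm_real]
    gcongr
    exact decay_bdd h _
  · filter_upwards with u
    have : Tendsto (fun x => k (u + x)) (cocompact ℝ) (𝓝 0) :=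
      (decay_tendsto h).comp (Homeomorph.addLeft u).isClosedEmbedding.tendsto_cocompact
    simpa using this.const_mul (f u : ℂ)

lemma laplace_fubini {T : ℝ → ℝ} {φ : ℝ → ℂ} (hφ : Integrable φ) (σ x : ℝ)
    (hT : Integrable fun u => T u * Real.exp (-(σ - 1) * u)) :
    ∫ t : ℝ, (∫ u : ℝ, (T u : ℂ) * Complex.exp (-((σ + t * Complex.I) - 1) * u)) * φ t *
      Complex.exp (-(x * t) * Complex.I) =
    ∫ u : ℝ, ((T u * Real.exp (-(σ - 1) * u) : ℝ) : ℂ) * ft φ (u + x) := by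
  have e1 : ∀ t : ℝ, (∫ u : ℝ, (T u : ℂ) * Complex.exp (-((σ + t * Complex.I) - 1) * u)) * φ t *
      Complex.exp (-(x * t) * Complex.I) =
      ∫ u : ℝ, ((T u * Real.exp (-(σ - 1) * u) : ℝ) : ℂ) * (φ t *
        Complex.exp (-((u + x : ℝ) * t) * Complex.I)) := by
    intro t
    rw [mul_assoc, ← integral_mul_const]
    congr 1
    ext u
    push_cast
    have : Complex.exp (-((σ + t * Complex.I) - 1) * u) * Complex.exp (-(x * t) * Complex.I) =
      Complex.exp (-(σ - 1) * u) * Complex.exp (-((u + x) * t) * Complex.I) := by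
      rw [← Complex.exp_add, ← Complex.exp_add]
      congr 1
      ring
    linear_combination (T u * φ t : ℂ) * this
  simp_rw [e1]
  rw [integral_integral_swap]
  · congr 1
    ext u
    rw [integral_const_mul]
    rfl
  · have h1 : Integrable (fun p : ℝ × ℝ => φ p.1 * ((T p.2 * Real.exp (-(σ - 1) * p.2) : ℝ) : ℂ))
        (volume.prod volume) := hφ.mul_prod hT.ofReal
    have h2 : Integrable (fun p : ℝ × ℝ => (φ p.1 * ((T p.2 * Real.exp (-(σ - 1) * p.2) : ℝ) : ℂ)) *
        Complex.exp (-((p.2 + x : ℝ) * p.1) * Complex.I)) (volume.prod volume) := by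
      refine h1.mul_bdd (c := 1) (by fun_prop) (Eventually.of_forall fun p => ?_)
      rw [show -(((p.2 + x : ℝ) : ℂ) * p.1) * Complex.I = ((-((p.2 + x) * p.1) : ℝ) : ℂ) * Complex.I by push_cast; ring,
        Complex.norm_exp_ofReal_mul_I]
    refine h2.congr (Eventually.of_forall fun p => ?_)
    simp only [Function.uncurry]
    ring

lemma abel_mono {p : ℝ → ℝ} (hp : ∀ u, 0 ≤ p u) (hz : ∀ u < 0, p u = 0)
    (hi : ∀ n : ℕ, Integrable fun u => p u * Real.exp (-(1 / ((n : ℝ) + 1)) * u)) {L : ℝ}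
    (hL : Tendsto (fun n : ℕ => ∫ u, p u * Real.exp (-(1 / ((n : ℝ) + 1)) * u)) atTop (𝓝 L)) :
    Integrable p ∧ ∫ u, p u = L := by
  have hpt : ∀ u, Tendsto (fun n : ℕ => p u * Real.exp (-(1 / ((n : ℝ) + 1)) * u)) atTop (𝓝 (p u)) := by
    intro u
    have h1 : Tendsto (fun n : ℕ => (1 / ((n : ℝ) + 1))) atTop (𝓝 0) :=
      tendsto_one_div_add_atTop_nhds_zero_nat
    have h2 := ((Real.continuous_exp.tendsto _).comp ((h1.neg).mul_const u)).const_mul (p u)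
    simpa [Function.comp_def] using h2
  have hnn : ∀ (n : ℕ) u, 0 ≤ p u * Real.exp (-(1 / ((n : ℝ) + 1)) * u) := fun n u =>
    mul_nonneg (hp u) (Real.exp_pos _).le
  have hpi : Integrable p := by
    refine integrable_of_tendsto (Eventually.of_forall hpt) (fun n => (hi n).aestronglyMeasurable) ?_
    have h3 : ∀ n : ℕ, ∫⁻ u, ‖p u * Real.exp (-(1 / ((n : ℝ) + 1)) * u)‖ₑ =
        ENNReal.ofReal (∫ u, p u * Real.exp (-(1 / ((n : ℝ) + 1)) * u)) := by
      intro n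
      rw [ofReal_integral_eq_lintegral_ofReal (hi n) (Eventually.of_forall (hnn n))]
      congr 1
      ext u
      rw [Real.enorm_of_nonneg (hnn n u)]
    simp_rw [h3]
    rw [(ENNReal.tendsto_ofReal hL).liminf_eq]
    exact ENNReal.ofReal_ne_top
  refine ⟨hpi, tendsto_nhds_unique (tendsto_integral_of_dominated_convergence p
    (fun n => (hi n).aestronglyMeasurable) hpi (fun n => Eventually.of_forall fun u => ?_)
    (Eventually.of_forall hpt)) hL⟩
  rw [Real.norm_of_nonneg (hnn n u)]
  by_cases hu : u < 0
  · simp [hz u hu]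
  · push Not at hu
    refine mul_le_of_le_one_right (hp u) ?_
    rw [Real.exp_le_one_iff]
    have : 0 ≤ (1 / ((n : ℝ) + 1)) * u := by positivity
    linarith

/-- dominated convergence for Abel factors -/
lemma abel_dct {q : ℝ → ℂ} (hz : ∀ u < 0, q u = 0) (hi : Integrable q) :
    (∀ σ : ℝ, 0 ≤ σ → Integrable fun u => q u * Real.exp (-σ * u)) ∧
    Tendsto (fun σ : ℝ => ∫ u, q u * Real.exp (-(σ - 1) * u)) (𝓝[>] 1) (𝓝 (∫ u, q u)) := by
  have hb : ∀ σ : ℝ, 0 ≤ σ → ∀ u, ‖q u * Real.exp (-σ * u)‖ ≤ ‖q u‖ := by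
    intro σ hσ u
    by_cases hu : u < 0
    · simp [hz u hu]
    · push Not at hu
      rw [norm_mul, Complex.norm_real, Real.norm_of_nonneg (Real.exp_pos _).le]
      refine mul_le_of_le_one_right (norm_nonneg _) ?_
      rw [Real.exp_le_one_iff]
      have : 0 ≤ σ * u := by positivity
      linarith
  have hm : ∀ σ : ℝ, AEStronglyMeasurable (fun u => q u * Real.exp (-σ * u)) := fun σ =>
    hi.aestronglyMeasurable.mul (by fun_prop)
  refine ⟨fun σ hσ => hi.norm.mono' (hm σ) (Eventually.of_forall (hb σ hσ)), ?_⟩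
  refine tendsto_integral_filter_of_dominated_convergence (fun u => ‖q u‖)
    (Eventually.of_forall fun σ => hm _) ?_ hi.norm ?_
  · filter_upwards [self_mem_nhdsWithin] with σ hσ
    exact Eventually.of_forall (hb _ (by linarith [mem_Ioi.1 hσ]))
  · filter_upwards with u
    apply Tendsto.mono_left _ nhdsWithin_le_nhds
    have : Continuous fun σ : ℝ => q u * ((Real.exp (-(σ - 1) * u) : ℝ) : ℂ) := by fun_prop
    have := this.tendsto 1
    simpa using this

lemma aesm_of_loc {T : ℝ → ℝ} (hloc : ∀ Y, IntegrableOn T (Iic Y)) : AEStronglyMeasurable T := by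
  have : AEStronglyMeasurable T (volume.restrict (⋃ n : ℕ, Iic (n : ℝ))) :=
    aestronglyMeasurable_iUnion_iff.2 fun n => (hloc n).aestronglyMeasurable
  have hu : (⋃ n : ℕ, Iic (n : ℝ)) = univ := by
    refine eq_univ_of_forall fun x => ?_
    obtain ⟨n, hn⟩ := exists_nat_ge x
    exact mem_iUnion.2 ⟨n, hn⟩
  rwa [hu, Measure.restrict_univ] at this

lemma exp_le_of_zero {T : ℝ → ℝ} (hz : ∀ u ≤ 0, T u = 0) {σ : ℝ} (hσ : 0 ≤ σ) (u : ℝ) :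
    ‖T u * Real.exp (-σ * u)‖ ≤ ‖T u‖ := by
  by_cases hu : u ≤ 0
  · simp [hz u hu]
  · push Not at hu
    rw [norm_mul, Real.norm_of_nonneg (Real.exp_pos _).le]
    refine mul_le_of_le_one_right (norm_nonneg _) ?_
    rw [Real.exp_le_one_iff]
    have : 0 ≤ σ * u := by positivity
    linarith

lemma intIic {T : ℝ → ℝ} (hz : ∀ u ≤ 0, T u = 0) (hloc : ∀ Y, IntegrableOn T (Iic Y)) {σ : ℝ}
    (hσ : 0 ≤ σ) (Y : ℝ) : IntegrableOn (fun u => T u * Real.exp (-σ * u)) (Iic Y) := by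
  refine (hloc Y).norm.mono' ((hloc Y).aestronglyMeasurable.mul (by fun_prop)) ?_
  exact Eventually.of_forall fun u => exp_le_of_zero hz hσ u

lemma fwd_integrable {T : ℝ → ℝ} (hz : ∀ u ≤ 0, T u = 0) (hloc : ∀ Y, IntegrableOn T (Iic Y))
    (hT : Tendsto T atTop (𝓝 0)) {σ : ℝ} (hσ : 0 < σ) :
    Integrable (fun u => T u * Real.exp (-σ * u)) := by
  obtain ⟨U, hU⟩ := eventually_atTop.1 (hT.eventually (Metric.ball_mem_nhds 0 one_pos))
  rw [← integrableOn_univ, ← Iic_union_Ioi (a := U), integrableOn_union]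
  refine ⟨intIic hz hloc hσ.le U, ?_⟩
  have h1 : IntegrableOn (fun u : ℝ => Real.exp (-σ * u)) (Ioi U) := exp_neg_integrableOn_Ioi U hσ
  refine h1.mono' ((aesm_of_loc hloc).restrict.mul (by fun_prop)) ?_
  filter_upwards [ae_restrict_mem measurableSet_Ioi] with u hu
  rw [norm_mul, Real.norm_of_nonneg (Real.exp_pos _).le]
  have := hU u (le_of_lt hu)
  rw [dist_zero_right] at this
  exact mul_le_of_le_one_left (Real.exp_pos _).le this.le

lemma fwd_pseudo {T : ℝ → ℝ} (hz : ∀ u ≤ 0, T u = 0) (hloc : ∀ Y, IntegrableOn T (Iic Y))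
    (hT : Tendsto T atTop (𝓝 0)) (G : ℂ → ℂ)
    (hG : ∀ s : ℂ, 1 < s.re → G s = ∫ u : ℝ, (T u : ℂ) * Complex.exp (-(s - 1) * u)) :
    LocalPseudofunctionBoundary G univ := by
  intro φ h1 h2 _
  obtain ⟨hc, C, hC0, hC⟩ := ft_facts φ h1 h2
  have hφi : Integrable φ := h1.continuous.integrable_of_hasCompactSupport h2
  obtain ⟨U, hU⟩ := eventually_atTop.1 (hT.eventually (Metric.ball_mem_nhds 0 one_pos))
  set T1 := (Iic U).indicator T with hT1
  set T2 := (Ioi U).indicator T with hT2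
  have hT12 : ∀ u, T u = T1 u + T2 u := by
    intro u
    have := indicator_self_add_compl (Iic U) T
    rw [compl_Iic] at this
    exact (congrFun this u).symm
  have hT1i : Integrable T1 := (hloc U).integrable_indicator measurableSet_Iic
  have hT2m : AEStronglyMeasurable T2 := (aesm_of_loc hloc).indicator measurableSet_Ioi
  have hT2b : ∀ u, ‖T2 u‖ ≤ 1 := by
    intro u
    by_cases hu : u ∈ Ioi U
    · rw [hT2, indicator_of_mem hu]
      have := hU u (le_of_lt hu)
      rw [dist_zero_right] at this
      exact this.le
    · rw [hT2, indicator_of_notMem hu]; simp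
  have hT2z : Tendsto T2 (cocompact ℝ) (𝓝 0) := by
    rw [cocompact_eq_atBot_atTop, tendsto_sup]
    constructor
    · apply tendsto_const_nhds.congr'
      filter_upwards [eventually_le_atBot U] with u hu
      rw [hT2, indicator_of_notMem (by simpa using hu)]
    · apply hT.congr'
      filter_upwards [eventually_gt_atTop U] with u hu
      rw [hT2, indicator_of_mem (by simpa using hu)]
  have hki := decay_integrable' hc hC
  have hi1 : ∀ x, Integrable fun u => (T1 u : ℂ) * ft φ (u + x) := fun x =>
    hT1i.ofReal.mul_bdd (c := C) (hc.comp (continuous_add_const x)).aestronglyMeasurable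
      (Eventually.of_forall fun u => decay_bdd hC _)
  have hi2 : ∀ x, Integrable fun u => (T2 u : ℂ) * ft φ (u + x) := fun x =>
    (hki.comp_add_right x).bdd_mul (c := 1)
      (Complex.continuous_ofReal.comp_aestronglyMeasurable hT2m)
      (Eventually.of_forall fun u => by simpa using hT2b u)
  have hi : ∀ x, Integrable fun u => (T u : ℂ) * ft φ (u + x) := fun x => by
    refine ((hi1 x).add (hi2 x)).congr (Eventually.of_forall fun u => ?_)
    simp only [Pi.add_apply, hT12 u]
    push_cast
    ring
  refine ⟨fun x => ∫ u, (T u : ℂ) * ft φ (u + x), fun x => ?_, ?_⟩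
  · have h3 := (abel_dct (q := fun u => (T u : ℂ) * ft φ (u + x))
      (fun u hu => by simp [hz u hu.le]) (hi x)).2
    refine h3.congr' ?_
    filter_upwards [self_mem_nhdsWithin] with σ hσ
    have hσ : 1 < σ := hσ
    have h4 := laplace_fubini (T := T) hφi σ x (fwd_integrable hz hloc hT (by linarith))
    rw [show (∫ t : ℝ, G (σ + t * Complex.I) * φ t * Complex.exp (-(x * t) * Complex.I)) =
      ∫ t : ℝ, (∫ u : ℝ, (T u : ℂ) * Complex.exp (-((σ + t * Complex.I) - 1) * u)) * φ t *
      Complex.exp (-(x * t) * Complex.I) from ?_, h4]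
    · congr 1
      ext u
      push_cast
      ring
    · congr 1
      ext t
      rw [hG _ (by simpa using hσ)]
  · have e : (fun x => ∫ u, (T u : ℂ) * ft φ (u + x)) = fun x => (∫ u, (T1 u : ℂ) * ft φ (u + x)) +
        ∫ u, (T2 (u - x) : ℂ) * ft φ u := by
      ext x
      have h5 := integral_add_right_eq_self (μ := volume) (fun u => (T2 (u - x) : ℂ) * ft φ u) x
      simp only [add_sub_cancel_right] at h5
      rw [← h5, ← integral_add (hi1 x) (hi2 x)]
      congr 1
      ext u
      rw [hT12 u]
      push_cast
      ring
    rw [e]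
    have l1 := conv_tendsto_zero hT1i hc hC
    have l2 : Tendsto (fun x => ∫ u, (T2 (u - x) : ℂ) * ft φ u) (cocompact ℝ) (𝓝 0) := by
      have h0 : (0:ℂ) = ∫ u : ℝ, (0:ℂ) := by simp
      rw [h0]
      refine tendsto_integral_filter_of_dominated_convergence (fun u => ‖ft φ u‖) ?_ ?_ hki.norm ?_
      · filter_upwards with x
        refine AEStronglyMeasurable.mul ?_ hc.aestronglyMeasurable
        exact Complex.continuous_ofReal.comp_aestronglyMeasurable
          (hT2m.comp_quasiMeasurePreserving (measurePreserving_sub_right volume x).quasiMeasurePreserving)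
      · filter_upwards with x
        filter_upwards with u
        rw [norm_mul, Complex.norm_real]
        exact mul_le_of_le_one_left (norm_nonneg _) (hT2b _)
      · filter_upwards with u
        have : Tendsto (fun x => T2 (u - x)) (cocompact ℝ) (𝓝 0) :=
          hT2z.comp (Homeomorph.subLeft u).isClosedEmbedding.tendsto_cocompact
        have := ((Complex.continuous_ofReal.tendsto _).comp this).mul_const (ft φ u)
        simpa [Function.comp_def] using this
    simpa using l1.add l2

lemma grow_of_sd {T : ℝ → ℝ} {δ V : ℝ} (hδ : 0 < δ)
    (hV : ∀ u ≥ V, ∀ h, 0 ≤ h → h ≤ δ → T u - 1 ≤ T (u + h)) :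
    ∀ u v, V ≤ u → u ≤ v → T u - (1 + 1 / δ) * (1 + (v - u)) ≤ T v := by
  have claim : ∀ n : ℕ, ∀ u v, V ≤ u → u ≤ v → v ≤ u + n * δ → T u - n ≤ T v := by
    intro n
    induction n with
    | zero =>
      intro u v _ h1 h2
      have : u = v := by push_cast at h2; linarith
      simp [this]
    | succ k ih =>
      intro u v hu h1 h2
      push_cast at h2 ⊢
      by_cases h3 : v ≤ u + δ
      · have := hV u hu (v - u) (by linarith) (by linarith)
        rw [add_sub_cancel] at this
        have : (0:ℝ) ≤ k := Nat.cast_nonneg k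
        linarith
      · push Not at h3
        have e1 := hV u hu δ hδ.le le_rfl
        have e2 := ih (u + δ) v (by linarith) h3.le (by linarith)
        linarith
  intro u v hu huv
  have h0 : 0 ≤ (v - u) / δ := div_nonneg (by linarith) hδ.le
  have h1 := Nat.le_ceil ((v - u) / δ)
  have h2 := (Nat.ceil_lt_add_one h0).le
  have h3 := claim ⌈(v - u) / δ⌉₊ u v hu huv (by rw [div_le_iff₀ hδ] at h1; linarith)
  have h4 : (v - u) / δ + 1 ≤ (1 + 1 / δ) * (1 + (v - u)) := by
    have : 0 ≤ 1 / δ := by positivity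
    have e : (v - u) / δ = (1 / δ) * (v - u) := by ring
    rw [e]
    nlinarith
  linarith

lemma bwd_integrable {T : ℝ → ℝ} (hz : ∀ u ≤ 0, T u = 0) (hloc : ∀ Y, IntegrableOn T (Iic Y))
    {U C : ℝ} (hU : 0 ≤ U) (hC : 0 ≤ C) (hlow : ∀ u ≥ U, 0 ≤ T u + C * (1 + u)) {σ l : ℝ} (hσ : 0 < σ)
    (hlim : Tendsto (fun Y : ℝ => ∫ u in (0:ℝ)..Y, T u * Real.exp (-σ * u)) atTop (𝓝 l)) :
    Integrable (fun u => T u * Real.exp (-σ * u)) := by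
  have hI := fun Y => intIic hz hloc hσ.le Y
  rw [← integrableOn_univ, ← Iic_union_Ioi (a := U), integrableOn_union]
  refine ⟨hI U, ?_⟩
  have hE : IntegrableOn (fun u : ℝ => C * (1 + u) * Real.exp (-σ * u)) (Ioi U) := by
    have h1 : IntegrableOn (fun u : ℝ => Real.exp (-σ * u)) (Ioi U) := exp_neg_integrableOn_Ioi U hσ
    have h2 : IntegrableOn (fun u : ℝ => u * Real.exp (-σ * u)) (Ioi U) := by
      have := integrableOn_rpow_mul_exp_neg_mul_rpow (p := 1) (s := 1) (b := σ) (by norm_num) one_pos hσ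
      simp only [Real.rpow_one] at this
      exact this.mono_set (Ioi_subset_Ioi hU)
    refine ((h1.add h2).const_mul C).congr (Eventually.of_forall fun u => ?_)
    simp only [Pi.add_apply]
    ring
  have hii : ∀ a b, IntervalIntegrable (fun u => T u * Real.exp (-σ * u)) volume a b := fun a b => by
    rw [intervalIntegrable_iff]
    exact (hI (max a b)).mono_set (by rw [uIoc]; exact Ioc_subset_Iic_self)
  have hEi : ∀ Y, U ≤ Y → IntervalIntegrable (fun u : ℝ => C * (1 + u) * Real.exp (-σ * u)) volume U Y := fun Y _ =>
    Continuous.intervalIntegrable (by fun_prop) _ _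
  have hP : IntegrableOn (fun u => T u * Real.exp (-σ * u) + C * (1 + u) * Real.exp (-σ * u)) (Ioi U) := by
    refine integrableOn_Ioi_of_intervalIntegral_norm_tendsto (b := fun Y : ℝ => Y) (l := atTop)
      ((l - ∫ u in (0:ℝ)..U, T u * Real.exp (-σ * u)) +
        ∫ u in Ioi U, C * (1 + u) * Real.exp (-σ * u)) U ?_ tendsto_id ?_
    · intro Y
      exact ((hI Y).mono_set Ioc_subset_Iic_self).add (hE.mono_set Ioc_subset_Ioi_self)
    · have l2 := intervalIntegral_tendsto_integral_Ioi U hE tendsto_id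
      refine ((hlim.sub_const _).add l2).congr' ?_
      filter_upwards [eventually_ge_atTop U] with Y hY
      rw [intervalIntegral.integral_interval_sub_left (hii _ _) (hii _ _),
        id, ← intervalIntegral.integral_add (hii _ _) (hEi Y hY)]
      refine intervalIntegral.integral_congr fun u hu => ?_
      rw [uIcc_of_le hY] at hu
      show _ = ‖_‖
      rw [← add_mul, Real.norm_of_nonneg (mul_nonneg (hlow u hu.1) (Real.exp_pos _).le)]
  refine (hP.sub hE).congr (Eventually.of_forall fun u => ?_)
  simp

lemma bwd_kernel {T : ℝ → ℝ} (hz : ∀ u ≤ 0, T u = 0) (hloc : ∀ Y, IntegrableOn T (Iic Y))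
    {U C : ℝ} (hU : 0 ≤ U) (hC : 0 ≤ C) (hlow : ∀ u ≥ U, 0 ≤ T u + C * (1 + u))
    (hTi : ∀ σ : ℝ, 0 < σ → Integrable (fun u => T u * Real.exp (-σ * u)))
    (G : ℂ → ℂ)
    (hG : ∀ s : ℂ, 1 < s.re → G s = ∫ u : ℝ, (T u : ℂ) * Complex.exp (-(s - 1) * u))
    (hP : LocalPseudofunctionBoundary G univ)
    {φ : ℝ → ℂ} (h1 : ContDiff ℝ (⊤ : ℕ∞) φ) (h2 : HasCompactSupport φ) {K : ℝ → ℝ}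
    (hK : ∀ y, ft φ y = K y) (hK0 : ∀ y, 0 ≤ K y) :
    (∀ y, Integrable fun u => (Ici U).indicator T u * K (u - y)) ∧
      Tendsto (fun y => ∫ u, (Ici U).indicator T u * K (u - y)) atTop (𝓝 0) := by
  obtain ⟨hc, C', hC'0, hC'⟩ := ft_facts φ h1 h2
  have hφi : Integrable φ := h1.continuous.integrable_of_hasCompactSupport h2
  have hKn : ∀ y, ‖ft φ y‖ = K y := fun y => by
    rw [hK, Complex.norm_real, Real.norm_of_nonneg (hK0 y)]
  have hKc : Continuous K := by
    have : K = fun y => ‖ft φ y‖ := by ext; rw [hKn]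
    rw [this]; fun_prop
  have hKb : ∀ y, ‖K y‖ ≤ C' := fun y => by
    rw [Real.norm_of_nonneg (hK0 y), ← hKn]; exact decay_bdd hC' y
  have hKw := decay_integrable hc hC'
  simp only [hKn] at hKw
  obtain ⟨g, hg, hg0⟩ := hP φ h1 h2 (subset_univ _)
  set f := (Ici U).indicator T with hf
  set T1 := (Iio U).indicator T with hT1
  have hT1f : ∀ u, T u = f u + T1 u := by
    intro u
    have := indicator_self_add_compl (Ici U) T
    rw [compl_Ici] at this
    exact (congrFun this u).symm
  have hT1i : Integrable T1 :=
    ((hloc U).mono_set Iio_subset_Iic_self).integrable_indicator measurableSet_Iio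
  have hT1K : ∀ y, Integrable fun u => T1 u * K (u - y) := fun y =>
    hT1i.mul_bdd (c := C') (hKc.comp (continuous_sub_right y)).aestronglyMeasurable
      (Eventually.of_forall fun u => hKb _)
  have hTK : ∀ y, Integrable (fun u => T u * K (u - y)) ∧ ∫ u, T u * K (u - y) = (g (-y)).re := by
    intro y
    let e : ℝ → ℝ := fun u => (Ici U).indicator (fun u => C * (1 + u)) u - T1 u
    have hez : ∀ u < 0, e u = 0 := by
      intro u hu
      simp only [e, hT1]
      rw [indicator_of_notMem (by simp; linarith), indicator_apply]
      simp [hz u hu.le]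
    have heK : Integrable fun u => e u * K (u - y) := by
      have : Integrable fun u => (Ici U).indicator (fun u => C * (1 + u)) u * K (u - y) := by
        have h3 := (hKw.comp_sub_right y).const_mul (C * (1 + |y|))
        refine h3.mono' ?_ ?_
        · refine AEStronglyMeasurable.mul ?_ (hKc.comp (continuous_sub_right y)).aestronglyMeasurable
          exact AEStronglyMeasurable.indicator (by fun_prop) measurableSet_Ici
        · filter_upwards with u
          rw [norm_mul, Real.norm_of_nonneg (hK0 _)]
          have : ‖(Ici U).indicator (fun u => C * (1 + u)) u‖ ≤ C * ((1 + |y|) * (1 + |u - y|)) := by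
            refine (norm_indicator_le_norm_self _ _).trans ?_
            rw [norm_mul, Real.norm_of_nonneg hC]
            gcongr
            rw [Real.norm_eq_abs]
            have a1 : |1 + u| ≤ 1 + |u| := by
              have := abs_add_le 1 u; simpa using this
            have a2 : |u| ≤ |y| + |u - y| := by
              have := abs_add_le y (u - y); simpa using this
            nlinarith [mul_nonneg (abs_nonneg y) (abs_nonneg (u - y))]
          calc _ ≤ C * ((1 + |y|) * (1 + |u - y|)) * K (u - y) :=
                mul_le_mul_of_nonneg_right this (hK0 _)
            _ = _ := by ring
      refine (this.sub (hT1K y)).congr (Eventually.of_forall fun u => ?_)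
      simp only [e, Pi.sub_apply]
      ring
    obtain ⟨d1, d2⟩ := abel_dct (q := fun u => ((e u * K (u - y) : ℝ) : ℂ))
      (fun u hu => by simp [hez u hu]) heK.ofReal
    have hTKi : ∀ σ : ℝ, 0 < σ → Integrable fun u => T u * Real.exp (-σ * u) * K (u - y) := fun σ hσ =>
      (hTi σ hσ).mul_bdd (c := C') (hKc.comp (continuous_sub_right y)).aestronglyMeasurable
        (Eventually.of_forall fun u => hKb _)
    have hgl : Tendsto (fun σ : ℝ => ((∫ u, T u * Real.exp (-(σ - 1) * u) * K (u - y) : ℝ) : ℂ))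
        (𝓝[>] 1) (𝓝 (g (-y))) := by
      refine (hg (-y)).congr' ?_
      filter_upwards [self_mem_nhdsWithin] with σ hσ
      have hσ : 1 < σ := hσ
      have h4 := laplace_fubini (T := T) hφi σ (-y) (hTi _ (by linarith))
      rw [show (∫ t : ℝ, G (σ + t * Complex.I) * φ t * Complex.exp (-((-y : ℝ) * t) * Complex.I)) =
        ∫ t : ℝ, (∫ u : ℝ, (T u : ℂ) * Complex.exp (-((σ + t * Complex.I) - 1) * u)) * φ t *
        Complex.exp (-((-y : ℝ) * t) * Complex.I) from ?_, h4]
      · rw [← integral_complex_ofReal]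
        congr 1
        ext u
        rw [hK, ← sub_eq_add_neg]
        push_cast
        ring
      · congr 1
        ext t
        rw [hG _ (by simpa using hσ)]
    have hsum := (Complex.continuous_re.tendsto _).comp (hgl.add d2)
    have hseq : Tendsto (fun n : ℕ => (1 : ℝ) + 1 / ((n : ℝ) + 1)) atTop (𝓝[>] 1) := by
      rw [tendsto_nhdsWithin_iff]
      constructor
      · have := (tendsto_one_div_add_atTop_nhds_zero_nat (𝕜 := ℝ)).const_add 1
        simpa using this
      · filter_upwards with n
        simp only [mem_Ioi]
        have : 0 < 1 / ((n : ℝ) + 1) := by positivity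
        linarith
    have hsum2 := hsum.comp hseq
    let p : ℝ → ℝ := fun u => (T u + e u) * K (u - y)
    have hpe : ∀ u, T u + e u = (Ici U).indicator (fun u => T u + C * (1 + u)) u := by
      intro u
      simp only [e]
      rw [hT1f u, hf, hT1]
      by_cases hu : u ∈ Ici U
      · have : u ∉ Iio U := by simpa using hu
        simp [indicator_of_mem hu, indicator_of_notMem this]
      · simp [indicator_of_notMem hu]
    have hp0 : ∀ u, 0 ≤ p u := fun u => by
      refine mul_nonneg ?_ (hK0 _)
      rw [hpe]
      exact indicator_nonneg (fun u hu => hlow u hu) u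
    have hsplit : ∀ (σ u : ℝ), p u * Real.exp (-σ * u) = T u * Real.exp (-σ * u) * K (u - y) +
        (e u * K (u - y)) * Real.exp (-σ * u) := fun σ u => by simp only [p]; ring
    have hei : ∀ σ : ℝ, 0 < σ → Integrable fun u => (e u * K (u - y)) * Real.exp (-σ * u) := by
      intro σ hσ
      have := (d1 σ hσ.le).re
      refine this.congr (Eventually.of_forall fun u => ?_)
      simp only [← Complex.ofReal_mul, RCLike.re_to_complex, Complex.ofReal_re]
    have hpos : ∀ n : ℕ, 0 < 1 / ((n : ℝ) + 1) := fun n => by positivity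
    obtain ⟨p1, p2⟩ := abel_mono (p := p) hp0 (fun u hu => by simp [p, hez u hu, hz u hu.le])
      (L := (g (-y) + ∫ u, ((e u * K (u - y) : ℝ) : ℂ)).re)
      (fun n => by
        simp_rw [hsplit]
        exact (hTKi _ (hpos n)).add (hei _ (hpos n)))
      (by
        refine hsum2.congr fun n => ?_
        simp_rw [hsplit]
        rw [integral_add (hTKi _ (hpos n)) (hei _ (hpos n))]
        simp only [Function.comp_apply, add_sub_cancel_left, ← Complex.ofReal_mul,
          integral_complex_ofReal, ← Complex.ofReal_add, Complex.ofReal_re])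
    have hpi : ∀ u, T u * K (u - y) = p u - e u * K (u - y) := fun u => by simp only [p]; ring
    constructor
    · simp_rw [hpi]
      exact p1.sub heK
    · simp_rw [hpi]
      rw [integral_sub p1 heK, p2, integral_complex_ofReal]
      simp
  have hfK : ∀ y u, f u * K (u - y) = T u * K (u - y) - T1 u * K (u - y) := fun y u => by
    rw [hT1f u]; ring
  simp_rw [hfK]
  refine ⟨fun y => (hTK y).1.sub (hT1K y), ?_⟩
  have hneg : Tendsto (fun y : ℝ => -y) atTop (cocompact ℝ) :=
    tendsto_neg_atTop_atBot.mono_right atBot_le_cocompact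
  have l1 := (Complex.continuous_re.tendsto _).comp (hg0.comp hneg)
  have l2 := (Complex.continuous_re.tendsto _).comp ((conv_tendsto_zero hT1i hc hC').comp hneg)
  have l3 := l1.sub l2
  simp only [Complex.zero_re, sub_zero] at l3
  refine l3.congr fun y => ?_
  rw [integral_sub (hTK y).1 (hT1K y), (hTK y).2]
  simp only [Function.comp_apply, hK, ← sub_eq_add_neg, ← Complex.ofReal_mul,
    integral_complex_ofReal, Complex.ofReal_re]

lemma bwd_s11 {T : ℝ → ℝ} (hz : ∀ u ≤ 0, T u = 0) (hloc : ∀ Y, IntegrableOn T (Iic Y)) (G : ℂ → ℂ)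
    (hG : ∀ s : ℂ, 1 < s.re → Tendsto
      (fun Y : ℝ => ∫ u in (0:ℝ)..Y, (T u : ℂ) * Complex.exp (-(s - 1) * u)) atTop (𝓝 (G s)))
    (hsd : ∀ ε : ℝ, 0 < ε → ∃ δ : ℝ, 0 < δ ∧ ∃ V : ℝ, ∀ u ≥ V, ∀ h, 0 ≤ h → h ≤ δ →
      T u - ε ≤ T (u + h))
    (hP : LocalPseudofunctionBoundary G univ) : Tendsto T atTop (𝓝 0) := by
  obtain ⟨δ, hδ, V, hV⟩ := hsd 1 one_pos
  set U := max V 0 with hUdef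
  have hU : 0 ≤ U := le_max_right _ _
  have hgrow : ∀ u v, U ≤ u → u ≤ v → T u - (1 + 1 / δ) * (1 + (v - u)) ≤ T v :=
    fun u v hu => grow_of_sd hδ hV u v ((le_max_left _ _).trans hu)
  have hC0 : 0 ≤ 1 + 1 / δ := by positivity
  set C1 := |T U| + (1 + 1 / δ) with hC1
  have hC10 : 0 ≤ C1 := by positivity
  have hlow : ∀ u ≥ U, 0 ≤ T u + C1 * (1 + u) := by
    intro u hu
    have h1 := hgrow U u le_rfl hu
    have hu0 : 0 ≤ u := hU.trans hu
    have h2 := neg_abs_le (T U)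
    have h3 : 0 ≤ |T U| * u := by positivity
    have h4 : 0 ≤ (1 + 1 / δ) * U := by positivity
    rw [hC1]
    nlinarith
  have hTi : ∀ σ : ℝ, 0 < σ → Integrable (fun u => T u * Real.exp (-σ * u)) := by
    intro σ hσ
    have h1 := hG ((1 + σ : ℝ) : ℂ) (by simpa using hσ)
    have h2 := (Complex.continuous_re.tendsto _).comp h1
    refine bwd_integrable hz hloc hU hC10 hlow hσ (l := (G ((1 + σ : ℝ) : ℂ)).re) (h2.congr fun Y => ?_)
    have : ∀ u : ℝ, (T u : ℂ) * Complex.exp (-(((1 + σ : ℝ) : ℂ) - 1) * u) =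
        ((T u * Real.exp (-σ * u) : ℝ) : ℂ) := by
      intro u
      push_cast
      simp
    simp only [Function.comp_apply, this]
    rw [intervalIntegral.integral_ofReal, Complex.ofReal_re]
  have hG' : ∀ s : ℂ, 1 < s.re → G s = ∫ u : ℝ, (T u : ℂ) * Complex.exp (-(s - 1) * u) := by
    intro s hs
    have hi : Integrable fun u : ℝ => (T u : ℂ) * Complex.exp (-(s - 1) * u) := by
      refine (hTi (s.re - 1) (by linarith)).norm.mono' ?_ ?_
      · exact (Complex.continuous_ofReal.comp_aestronglyMeasurable (aesm_of_loc hloc)).mul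
          (by fun_prop)
      · filter_upwards with u
        rw [norm_mul, norm_mul, Complex.norm_exp, Complex.norm_real,
          Real.norm_of_nonneg (Real.exp_pos _).le]
        simp
    have h1 := intervalIntegral_tendsto_integral_Ioi 0 hi.integrableOn tendsto_id
    rw [setIntegral_eq_integral_of_forall_compl_eq_zero] at h1
    · exact tendsto_nhds_unique (hG s hs) h1
    · intro u hu
      simp [hz u (by simpa using hu)]
  have key : Tendsto ((Ici U).indicator T) atTop (𝓝 0) := by
    refine taub_main hC0 (U := U) ?_ ?_ hU ?_ ?_
    · intro d ε hd hε
      obtain ⟨φ, h1, h2, K, hK, hK0, hK1, htail⟩ := kernel_exists d ε hd hε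
      obtain ⟨hc, C', hC'0, hC'⟩ := ft_facts φ h1 h2
      have hKn : ∀ y, ‖ft φ y‖ = K y := fun y => by
        rw [hK, Complex.norm_real, Real.norm_of_nonneg (hK0 y)]
      have hKc : Continuous K := by
        have : K = fun y => ‖ft φ y‖ := by ext; rw [hKn]
        rw [this]; fun_prop
      have hKw := decay_integrable hc hC'
      simp only [hKn] at hKw
      obtain ⟨k1, k2⟩ := bwd_kernel hz hloc hU hC10 hlow hTi G hG' hP h1 h2 hK hK0
      exact ⟨K, hK0, hKc, hKw, hK1, htail, k1, k2⟩
    · intro ε hε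
      obtain ⟨d, hd, W, hW⟩ := hsd ε hε
      refine ⟨d, hd, max W U, fun u hu h h0 h1 => ?_⟩
      have hu1 : U ≤ u := (le_max_right _ _).trans hu
      rw [indicator_of_mem (show u ∈ Ici U from hu1),
        indicator_of_mem (show u + h ∈ Ici U from le_trans hu1 (by linarith))]
      exact hW u ((le_max_left _ _).trans hu) h h0 h1
    · intro u hu
      exact indicator_of_notMem (by simpa using hu) _
    · intro u v hu huv
      rw [indicator_of_mem (show u ∈ Ici U from hu),
        indicator_of_mem (show v ∈ Ici U from hu.trans huv)]
      exact hgrow u v hu huv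
  refine key.congr' ?_
  filter_upwards [eventually_ge_atTop U] with u hu
  exact indicator_of_mem (show u ∈ Ici U from hu) _

lemma lap_lin (a b : ℝ) (z : ℂ) (hz : 0 < z.re) :
    Tendsto (fun Y : ℝ => ∫ u in (0:ℝ)..Y, ((a * u + b : ℝ) : ℂ) * Complex.exp (-z * u)) atTop
      (𝓝 (a / z ^ 2 + b / z)) := by
  have hz0 : z ≠ 0 := by rintro rfl; simp at hz
  have hexp : ∀ u : ℝ, ‖Complex.exp (-z * u)‖ = Real.exp (-z.re * u) := fun u => by
    rw [Complex.norm_exp]; simp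
  have hder : ∀ u : ℝ, HasDerivAt (fun u : ℝ => -(a * (u / z + 1 / z ^ 2) + b / z) * Complex.exp (-z * u))
      (((a * u + b : ℝ) : ℂ) * Complex.exp (-z * u)) u := by
    intro u
    have h1 : HasDerivAt (fun u : ℝ => (u : ℂ)) 1 u := Complex.ofRealCLM.hasDerivAt
    have h2 : HasDerivAt (fun u : ℝ => -(a * (u / z + 1 / z ^ 2) + b / z)) (-(a * (1 / z))) u :=
      ((((h1.div_const z).add_const (1 / z ^ 2)).const_mul (a : ℂ)).add_const (b / z)).neg
    have h3 := (h1.const_mul (-z)).cexp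
    refine (h2.mul h3).congr_deriv ?_
    push_cast
    field_simp
    ring
  have hlim : Tendsto (fun u : ℝ => -(a * (u / z + 1 / z ^ 2) + b / z) * Complex.exp (-z * u)) atTop (𝓝 0) := by
    have e0 : Tendsto (fun u : ℝ => Complex.exp (-z * u)) atTop (𝓝 0) := by
      rw [tendsto_zero_iff_norm_tendsto_zero]
      simp_rw [hexp]
      have := tendsto_rpow_mul_exp_neg_mul_atTop_nhds_zero 0 z.re hz
      simpa using this
    have e1 : Tendsto (fun u : ℝ => (u : ℂ) * Complex.exp (-z * u)) atTop (𝓝 0) := by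
      rw [tendsto_zero_iff_norm_tendsto_zero]
      have := tendsto_rpow_mul_exp_neg_mul_atTop_nhds_zero 1 z.re hz
      refine this.congr' ?_
      filter_upwards [eventually_ge_atTop 0] with u hu
      rw [norm_mul, hexp, Complex.norm_real, Real.norm_of_nonneg hu, Real.rpow_one]
    have := (e1.const_mul (-(a / z))).add (e0.const_mul (-(a / z ^ 2 + b / z)))
    simp only [mul_zero, add_zero] at this
    refine this.congr fun u => ?_
    ring
  have hcont : Continuous (fun u : ℝ => ((a * u + b : ℝ) : ℂ) * Complex.exp (-z * u)) := by fun_prop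
  have h4 : ∀ Y : ℝ, ∫ u in (0:ℝ)..Y, ((a * u + b : ℝ) : ℂ) * Complex.exp (-z * u) =
      -(a * (Y / z + 1 / z ^ 2) + b / z) * Complex.exp (-z * Y) + (a / z ^ 2 + b / z) := by
    intro Y
    rw [intervalIntegral.integral_eq_sub_of_hasDerivAt (fun u _ => hder u)
      (hcont.intervalIntegrable _ _)]
    simp
    ring
  simp_rw [h4]
  simpa using hlim.add_const (a / z ^ 2 + b / z : ℂ)

lemma exp_image_Ioc (Y : ℝ) : Set.image Real.exp (Ioc 0 Y) = Ioc 1 (Real.exp Y) := by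
  ext x
  constructor
  · rintro ⟨u, hu, rfl⟩
    exact ⟨Real.one_lt_exp_iff.2 hu.1, Real.exp_le_exp.2 hu.2⟩
  · intro hx
    have h0 : 0 < x := by linarith [hx.1]
    exact ⟨Real.log x, ⟨Real.log_pos hx.1, (Real.log_le_iff_le_exp h0).2 hx.2⟩, Real.exp_log h0⟩

lemma mellin_change (τ : ℝ → ℝ) (s : ℂ) {Y : ℝ} (hY : 0 ≤ Y) :
    ∫ x in (1:ℝ)..(Real.exp Y), (τ x : ℂ) * (x : ℂ) ^ (-s) =
      ∫ u in (0:ℝ)..Y, (τ (Real.exp u) : ℂ) * Complex.exp (-(s - 1) * u) := by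
  rw [intervalIntegral.integral_of_le (Real.one_le_exp hY), intervalIntegral.integral_of_le hY,
    ← exp_image_Ioc, integral_image_eq_integral_abs_deriv_smul measurableSet_Ioc
      (fun u _ => (Real.hasDerivAt_exp u).hasDerivWithinAt) Real.exp_injective.injOn]
  congr 1
  ext u
  rw [abs_of_pos (Real.exp_pos u), Complex.real_smul, Complex.cpow_def_of_ne_zero
    (by exact_mod_cast (Real.exp_pos u).ne'), ← Complex.ofReal_log (Real.exp_pos u).le, Real.log_exp,
    Complex.ofReal_exp]
  rw [mul_left_comm, ← Complex.exp_add]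
  congr 2
  ring

lemma tau_exp_int {τ : ℝ → ℝ} (hloc : LocallyIntegrableOn τ (Set.Ici 1)) (Y : ℝ) :
    IntegrableOn (fun u => τ (Real.exp u)) (Ioc 0 Y) := by
  have h1 : IntegrableOn τ (Icc 1 (Real.exp Y)) :=
    hloc.integrableOn_compact_subset Icc_subset_Ici_self isCompact_Icc
  have h2 : IntegrableOn (fun x => τ x * x⁻¹) (Icc 1 (Real.exp Y)) := by
    refine h1.mul_continuousOn ?_ isCompact_Icc
    exact continuousOn_inv₀.mono fun x hx => by
      simp only [mem_compl_iff, mem_singleton_iff]; linarith [hx.1]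
  have h3 := h2.mono_set Ioc_subset_Icc_self
  rw [← exp_image_Ioc, integrableOn_image_iff_integrableOn_abs_deriv_smul measurableSet_Ioc
    (fun u _ => (Real.hasDerivAt_exp u).hasDerivWithinAt) Real.exp_injective.injOn] at h3
  refine h3.congr (Eventually.of_forall fun u => ?_)
  simp only [smul_eq_mul]
  rw [abs_of_pos (Real.exp_pos u)]
  have := (Real.exp_pos u).ne'
  field_simp

/-- Extension of the Ingham–Fatou–Riesz theorem. -/
theorem stmt_11 (τ : ℝ → ℝ) (hloc : LocallyIntegrableOn τ (Set.Ici 1))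
    (hsd : SlowlyDecreasing τ) (a b : ℝ) :
    Tendsto (fun x : ℝ => τ x - a * Real.log x - b) atTop (𝓝 0) ↔
      ∃ F : ℂ → ℂ,
        (∀ s : ℂ, 1 < s.re →
          Tendsto (fun X : ℝ => ∫ x in (1:ℝ)..X, (τ x : ℂ) * (x : ℂ) ^ (-s))
            atTop (𝓝 (F s))) ∧
        LocalPseudofunctionBoundary
          (fun s => F s - a / (s - 1) ^ 2 - b / (s - 1)) Set.univ := by
  let T : ℝ → ℝ := (Ioi 0).indicator fun u => τ (Real.exp u) - (a * u + b)
  have hTpos : ∀ u, 0 < u → T u = τ (Real.exp u) - (a * u + b) := fun u hu =>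
    indicator_of_mem (show u ∈ Ioi 0 from hu) _
  have hz : ∀ u ≤ 0, T u = 0 := fun u hu => indicator_of_notMem (by simpa using hu) _
  have hTloc : ∀ Y, IntegrableOn T (Iic Y) := by
    intro Y
    have h1 : IntegrableOn (fun u => τ (Real.exp u) - (a * u + b)) (Ioc 0 Y) :=
      (tau_exp_int hloc Y).sub ((Continuous.integrableOn_Icc (by fun_prop)).mono_set Ioc_subset_Icc_self)
    have h2 : IntegrableOn ((Ioi 0).indicator fun u => τ (Real.exp u) - (a * u + b)) (Iic Y) := by
      rw [integrableOn_indicator_iff measurableSet_Ioi, Ioi_inter_Iic]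
      exact h1
    exact h2
  have hTlim : Tendsto T atTop (𝓝 0) ↔ Tendsto (fun x : ℝ => τ x - a * Real.log x - b) atTop (𝓝 0) := by
    constructor
    · intro h
      refine (h.comp Real.tendsto_log_atTop).congr' ?_
      filter_upwards [eventually_gt_atTop 1] with x hx
      rw [Function.comp_apply, hTpos _ (Real.log_pos hx), Real.exp_log (by linarith)]
      ring
    · intro h
      refine (h.comp Real.tendsto_exp_atTop).congr' ?_
      filter_upwards [eventually_gt_atTop 0] with u hu
      rw [Function.comp_apply, hTpos _ hu, Real.log_exp]
      ring
  -- relation between the truncated transforms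
  have hrel : ∀ s : ℂ, ∀ Y : ℝ, 0 ≤ Y →
      ∫ x in (1:ℝ)..(Real.exp Y), (τ x : ℂ) * (x : ℂ) ^ (-s) =
      (∫ u in (0:ℝ)..Y, (T u : ℂ) * Complex.exp (-(s - 1) * u)) +
        ∫ u in (0:ℝ)..Y, ((a * u + b : ℝ) : ℂ) * Complex.exp (-(s - 1) * u) := by
    intro s Y hY
    rw [mellin_change τ s hY]
    rw [← intervalIntegral.integral_add]
    · rw [intervalIntegral.integral_of_le hY, intervalIntegral.integral_of_le hY]
      refine setIntegral_congr_fun measurableSet_Ioc fun u hu => ?_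
      rw [hTpos u hu.1]
      push_cast
      ring
    · rw [intervalIntegrable_iff, uIoc_of_le hY]
      have h1 : IntegrableOn (fun u => (T u : ℂ)) (Icc 0 Y) :=
        Integrable.ofReal ((hTloc Y).mono_set Icc_subset_Iic_self)
      exact (h1.mul_continuousOn (by fun_prop) isCompact_Icc).mono_set Ioc_subset_Icc_self
    · exact Continuous.intervalIntegrable (by fun_prop) _ _
  rw [← hTlim]
  constructor
  · intro hT
    let L : ℂ → ℂ := fun s => ∫ u : ℝ, (T u : ℂ) * Complex.exp (-(s - 1) * u)
    refine ⟨fun s => L s + (a / (s - 1) ^ 2 + b / (s - 1)), fun s hs => ?_, ?_⟩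
    · have hi : Integrable fun u : ℝ => (T u : ℂ) * Complex.exp (-(s - 1) * u) := by
        refine (fwd_integrable hz hTloc hT (σ := s.re - 1) (by linarith)).norm.mono' ?_ ?_
        · exact (Complex.continuous_ofReal.comp_aestronglyMeasurable (aesm_of_loc hTloc)).mul
            (by fun_prop)
        · filter_upwards with u
          rw [norm_mul, norm_mul, Complex.norm_exp, Complex.norm_real,
            Real.norm_of_nonneg (Real.exp_pos _).le]
          simp
      have h1 := intervalIntegral_tendsto_integral_Ioi 0 hi.integrableOn tendsto_id
      rw [setIntegral_eq_integral_of_forall_compl_eq_zero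
        (fun u hu => by simp [hz u (by simpa using hu)])] at h1
      have h2 := lap_lin a b (s - 1) (by simpa using hs)
      refine ((h1.add h2).comp Real.tendsto_log_atTop).congr' ?_
      filter_upwards [eventually_ge_atTop 1] with X hX
      have := hrel s (Real.log X) (Real.log_nonneg hX)
      rw [Real.exp_log (by linarith)] at this
      rw [this]
      rfl
    · refine fwd_pseudo hz hTloc hT _ fun s hs => ?_
      simp only [L]
      ring
  · rintro ⟨F, hF, hP⟩
    refine bwd_s11 hz hTloc _ (fun s hs => ?_) ?_ hP
    · have h1 := (hF s hs).comp Real.tendsto_exp_atTop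
      have h2 := h1.sub (lap_lin a b (s - 1) (by simpa using hs))
      rw [show F s - a / (s - 1) ^ 2 - b / (s - 1) = F s - (a / (s - 1) ^ 2 + b / (s - 1)) by ring]
      refine h2.congr' ?_
      filter_upwards [eventually_ge_atTop 0] with Y hY
      rw [Function.comp_apply, hrel s Y hY]
      ring
    · intro ε hε
      obtain ⟨c, hc, hc2⟩ := hsd (ε / 4) (by positivity)
      obtain ⟨X, hX⟩ := eventually_atTop.1 (hc2 (ε / 2) (by linarith))
      have hd2 : 0 < ε / (2 * (|a| + 1)) := by positivity
      refine ⟨min (Real.log c) (ε / (2 * (|a| + 1))), lt_min (Real.log_pos hc) hd2,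
        max 1 (Real.log (max X 1)), fun u hu h h0 h1 => ?_⟩
      have hu0 : 0 < u := lt_of_lt_of_le one_pos ((le_max_left _ _).trans hu)
      have hXu : X ≤ Real.exp u := by
        refine (le_max_left X 1).trans ?_
        rw [← Real.log_le_iff_le_exp (by positivity)]
        exact (le_max_right _ _).trans hu
      have h2 := hX _ hXu (Real.exp h) ⟨Real.one_le_exp h0, by
        rw [← Real.le_log_iff_exp_le (by linarith)]
        exact h1.trans (min_le_left _ _)⟩
      rw [← Real.exp_add, add_comm h u] at h2
      rw [hTpos u hu0, hTpos (u + h) (by linarith)]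
      have h3 : h ≤ ε / (2 * (|a| + 1)) := h1.trans (min_le_right _ _)
      have h4 : a * h ≤ ε / 2 := by
        calc a * h ≤ |a| * h := by gcongr; exact le_abs_self a
          _ ≤ (|a| + 1) * (ε / (2 * (|a| + 1))) := by gcongr; linarith
          _ = ε / 2 := by field_simp
      linarith
end
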